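/- arXiv:2106.15824 — 3 statements merged into one kernel-verified Lean document; each statement's English description precedes it below -/
import Mathlib

section
/- Let n > m ≥ 1 be integers and let c be a real number. Then the set of zeros of the harmonic quadrinomial with b = 0, namely q₀(z) = conj(z)^n + c·conj(z)^m + z, is finite and contains at most 3n − 2 points. -/
lemma phi_anti (R I : ℝ) (hI : 0 < I) (h : R ^ 2 + I ^ 2 ≤ 1) :
    StrictAntiOn (fun s : ℝ => (s + 1) * Real.arctan (I / (s + R))) (Set.Ici 1) := by
  have hR : -1 < R := by nlinarith
  have hR1 : R < 1 := by nlinarith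
  have hd : ∀ s : ℝ, 1 ≤ s → HasDerivAt (fun s : ℝ => (s + 1) * Real.arctan (I / (s + R)))
      (1 * Real.arctan (I / (s + R)) + (s + 1) * (1 / (1 + (I / (s + R)) ^ 2) *
        ((0 * (s + R) - I * 1) / (s + R) ^ 2))) s := by
    intro s hs
    have h1 : s + R ≠ 0 := by linarith
    have h2 : HasDerivAt (fun s : ℝ => s + R) 1 s := (hasDerivAt_id s).add_const R
    have h3 : HasDerivAt (fun s : ℝ => s + 1) 1 s := (hasDerivAt_id s).add_const 1
    exact h3.mul (((hasDerivAt_const s I).div h2 h1).arctan)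
  apply strictAntiOn_of_deriv_neg (convex_Ici 1)
  · intro s hs
    exact (hd s hs).continuousAt.continuousWithinAt
  · intro s hs
    rw [interior_Ici] at hs
    have hs' : 1 < s := hs
    rw [(hd s hs'.le).deriv]
    have ha : 0 < s + R := by linarith
    have ht : 0 < I / (s + R) := by positivity
    have hlt : Real.arctan (I / (s + R)) < I / (s + R) := by
      have h1 := Real.lt_tan (Real.arctan_pos.2 ht) (Real.arctan_lt_pi_div_two _)
      rwa [Real.tan_arctan] at h1
    have e : (s + 1) * (1 / (1 + (I / (s + R)) ^ 2) * ((0 * (s + R) - I * 1) / (s + R) ^ 2))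
        = - ((s + 1) * I / ((s + R) ^ 2 + I ^ 2)) := by
      have : (s + R) ^ 2 + I ^ 2 ≠ 0 := by positivity
      field_simp
      ring
    rw [e]
    have : I / (s + R) ≤ (s + 1) * I / ((s + R) ^ 2 + I ^ 2) := by
      rw [div_le_div_iff₀ ha (by positivity)]
      have : (s + R) ^ 2 + I ^ 2 ≤ (s + 1) * (s + R) := by nlinarith
      nlinarith
    linarith

lemma key_turn (n m x y : ℝ) (hm : 1 ≤ m) (hmn : m < n) (hx : 0 < x) (hxy : x < y)
    (hy : y < Real.pi)
    (H : n * (n - m) * Real.sin x ^ 2 + (m * n - 1) * Real.sin (y - x) ^ 2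
      ≤ m * (n - m) * Real.sin y ^ 2) :
    -Real.pi < (n + 1) * x - (m + 1) * y ∧ (n + 1) * x - (m + 1) * y < 0 := by
  have sx : 0 < Real.sin x := Real.sin_pos_of_pos_of_lt_pi hx (by linarith)
  have sy : 0 < Real.sin y := Real.sin_pos_of_pos_of_lt_pi (by linarith) hy
  have sw : 0 < Real.sin (y - x) := Real.sin_pos_of_pos_of_lt_pi (by linarith) (by linarith)
  have esw := Real.sin_sub y x
  have cx := Real.sin_sq_add_cos_sq x
  have cy := Real.sin_sq_add_cos_sq y
  set l := (n - m) / Real.sin (y - x) with hl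
  have hlp : 0 < l := div_pos (by linarith) sw
  have hlw : l * Real.sin (y - x) = n - m := by rw [hl]; field_simp
  set R := l * Real.sin y * Real.cos x - n with hR
  set I := l * Real.sin x * Real.sin y with hI
  have hIp : 0 < I := by positivity
  have hmR : m + R = l * Real.sin x * Real.cos y := by
    rw [hR]; rw [esw] at hlw; linarith
  have hnR : n + R = l * Real.sin y * Real.cos x := by rw [hR]; ring
  have hRI : R ^ 2 + I ^ 2 ≤ 1 := by
    have law : 2 * Real.cos x * Real.sin y * Real.sin (y - x)
        = Real.sin y ^ 2 + Real.sin (y - x) ^ 2 - Real.sin x ^ 2 := by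
      rw [esw]
      have cx' : Real.cos x ^ 2 = 1 - Real.sin x ^ 2 := by linarith
      have cy' : Real.cos y ^ 2 = 1 - Real.sin y ^ 2 := by linarith
      ring_nf
      rw [cx', cy']
      ring
    have e1 : R ^ 2 + I ^ 2 = l ^ 2 * Real.sin y ^ 2 - 2 * n * l * Real.sin y * Real.cos x + n ^ 2 := by
      rw [hR, hI]
      have cx' : Real.cos x ^ 2 = 1 - Real.sin x ^ 2 := by linarith
      ring_nf
      rw [cx']
      ring
    have e2 : (R ^ 2 + I ^ 2) * Real.sin (y - x) ^ 2 = (n - m) ^ 2 * Real.sin y ^ 2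
        - n * (n - m) * (Real.sin y ^ 2 + Real.sin (y - x) ^ 2 - Real.sin x ^ 2)
        + n ^ 2 * Real.sin (y - x) ^ 2 := by
      rw [e1, ← law, ← hlw]; ring
    have e3 : (R ^ 2 + I ^ 2) * Real.sin (y - x) ^ 2 ≤ 1 * Real.sin (y - x) ^ 2 := by
      rw [e2]; linarith
    exact le_of_mul_le_mul_right e3 (by positivity)
  have hRm : -1 < R := by nlinarith
  have ccx : 0 < Real.cos x := by
    have : 0 < (l * Real.sin y) * Real.cos x := by rw [← hnR]; linarith
    exact (pos_iff_pos_of_mul_pos this).1 (by positivity)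
  have ccy : 0 < Real.cos y := by
    have : 0 < (l * Real.sin x) * Real.cos y := by rw [← hmR]; linarith
    exact (pos_iff_pos_of_mul_pos this).1 (by positivity)
  have ypi : y < Real.pi / 2 := by
    by_contra hc
    have := Real.cos_nonpos_of_pi_div_two_le_of_le (not_lt.1 hc) (by linarith)
    linarith
  have ax : Real.arctan (I / (n + R)) = x := by
    have : I / (n + R) = Real.tan x := by
      rw [hnR, hI, Real.tan_eq_sin_div_cos]; field_simp
    rw [this, Real.arctan_tan (by linarith) (by linarith)]
  have ay : Real.arctan (I / (m + R)) = y := by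
    have : I / (m + R) = Real.tan y := by
      rw [hmR, hI, Real.tan_eq_sin_div_cos]; field_simp
    rw [this, Real.arctan_tan (by linarith) (by linarith)]
  have A := phi_anti R I hIp hRI
  have h1 := A (show (m : ℝ) ∈ Set.Ici 1 from hm) (show n ∈ Set.Ici 1 from hm.trans hmn.le) hmn
  have h2 := A.antitoneOn Set.self_mem_Ici (show m ∈ Set.Ici 1 from hm) hm
  simp only [ax, ay] at h1 h2
  have h3 := Real.arctan_lt_pi_div_two (I / (1 + R))
  have h4 : 0 < (n + 1) * x := by nlinarith
  constructor
  · linarith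
  · linarith

lemma uniq_aux (n m x y x' y' : ℝ) (E : ℤ) (hm : 1 ≤ m) (hmn : m < n)
    (hx : 0 < x) (hxy : x < y) (hy : y < Real.pi)
    (hx' : 0 < x') (hxy' : x' < y') (hy' : y' < Real.pi)
    (he : (n + 1) * x - (m + 1) * y = Real.pi * E)
    (he' : (n + 1) * x' - (m + 1) * y' = Real.pi * E)
    (hK : (n - 1) * Real.log (Real.sin y) - (m - 1) * Real.log (Real.sin x)
        - (n - m) * Real.log (Real.sin (y - x))
      = (n - 1) * Real.log (Real.sin y') - (m - 1) * Real.log (Real.sin x')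
        - (n - m) * Real.log (Real.sin (y' - x'))) : ¬ x < x' := by
  intro hlt
  set t := (x' - x) / (m + 1) with ht
  have htp : 0 < t := div_pos (by linarith) (by linarith)
  have hxt : x' = x + (m + 1) * t := by rw [ht]; field_simp; ring
  have hyt : y' = y + (n + 1) * t := by
    have : (m + 1) * (y' - (y + (n + 1) * t)) = 0 := by
      rw [hxt] at he'
      linarith
    rcases mul_eq_zero.1 this with h | h <;> linarith
  let f : ℝ → ℝ := fun s => (n - 1) * Real.log (Real.sin (y + (n + 1) * s))
    - (m - 1) * Real.log (Real.sin (x + (m + 1) * s))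
    - (n - m) * Real.log (Real.sin ((y + (n + 1) * s) - (x + (m + 1) * s)))
  have reg : ∀ s ∈ Set.Icc 0 t, 0 < x + (m + 1) * s ∧ x + (m + 1) * s < y + (n + 1) * s ∧
      y + (n + 1) * s < Real.pi := by
    intro s hs
    have h1 : 0 ≤ (m + 1) * s := mul_nonneg (by linarith) hs.1
    have h2 : 0 ≤ (n - m) * s := mul_nonneg (by linarith) hs.1
    have h3 : (n + 1) * s ≤ (n + 1) * t := mul_le_mul_of_nonneg_left hs.2 (by linarith)
    refine ⟨by linarith, by linarith, by linarith⟩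
  have hd : ∀ s ∈ Set.Icc 0 t, HasDerivAt f
      ((n - 1) * (Real.cos (y + (n + 1) * s) * (n + 1) / Real.sin (y + (n + 1) * s))
        - (m - 1) * (Real.cos (x + (m + 1) * s) * (m + 1) / Real.sin (x + (m + 1) * s))
        - (n - m) * (Real.cos ((y + (n + 1) * s) - (x + (m + 1) * s)) * ((n + 1) - (m + 1))
          / Real.sin ((y + (n + 1) * s) - (x + (m + 1) * s)))) s := by
    intro s hs
    obtain ⟨r1, r2, r3⟩ := reg s hs
    have sx := Real.sin_pos_of_pos_of_lt_pi r1 (by linarith)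
    have sy := Real.sin_pos_of_pos_of_lt_pi (r1.trans r2) r3
    have sw := Real.sin_pos_of_pos_of_lt_pi (sub_pos.2 r2) (by linarith)
    have dl : ∀ a b : ℝ, HasDerivAt (fun s : ℝ => a + b * s) b s := by
      intro a b
      simpa using ((hasDerivAt_id s).const_mul b).const_add a
    exact ((((dl y (n+1)).sin.log sy.ne').const_mul (n - 1)).sub
      (((dl x (m+1)).sin.log sx.ne').const_mul (m - 1))).sub
      ((((dl y (n+1)).sub (dl x (m+1))).sin.log sw.ne').const_mul (n - m))
  have anti : StrictAntiOn f (Set.Icc 0 t) := by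
    apply strictAntiOn_of_deriv_neg (convex_Icc 0 t)
    · intro s hs
      exact (hd s hs).continuousAt.continuousWithinAt
    · intro s hs
      have hs' := interior_subset hs
      rw [(hd s hs').deriv]
      obtain ⟨r1, r2, r3⟩ := reg s hs'
      have hee : (n + 1) * (x + (m + 1) * s) - (m + 1) * (y + (n + 1) * s) = Real.pi * E := by
        rw [← he]; ring
      generalize x + (m + 1) * s = X at *
      generalize y + (n + 1) * s = Y at *
      have sx := Real.sin_pos_of_pos_of_lt_pi r1 (by linarith)
      have sy := Real.sin_pos_of_pos_of_lt_pi (r1.trans r2) r3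
      have sw := Real.sin_pos_of_pos_of_lt_pi (sub_pos.2 r2) (by linarith)
      have noturn : m * (n - m) * Real.sin Y ^ 2 < n * (n - m) * Real.sin X ^ 2
          + (m * n - 1) * Real.sin (Y - X) ^ 2 := by
        by_contra hc
        obtain ⟨k1, k2⟩ := key_turn n m X Y hm hmn r1 r2 r3 (not_lt.1 hc)
        rw [hee] at k1 k2
        have pp := Real.pi_pos
        have : (-1 : ℝ) < E := by nlinarith
        have h0 : (E : ℝ) < 0 := by nlinarith
        have : (-1 : ℤ) < E := by exact_mod_cast this
        have : E < 0 := by exact_mod_cast h0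
        omega
      have cx : Real.cos X ^ 2 = 1 - Real.sin X ^ 2 := by
        have := Real.sin_sq_add_cos_sq X; linarith
      have cy : Real.cos Y ^ 2 = 1 - Real.sin Y ^ 2 := by
        have := Real.sin_sq_add_cos_sq Y; linarith
      have l1 : 2 * Real.cos X * Real.sin Y * Real.sin (Y - X)
          = Real.sin Y ^ 2 + Real.sin (Y - X) ^ 2 - Real.sin X ^ 2 := by
        rw [Real.sin_sub]; ring_nf; rw [cx, cy]; ring
      have l2 : 2 * Real.cos Y * Real.sin X * Real.sin (Y - X)
          = Real.sin Y ^ 2 - Real.sin X ^ 2 - Real.sin (Y - X) ^ 2 := by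
        rw [Real.sin_sub]; ring_nf; rw [cx, cy]; ring
      have l3 : 2 * Real.cos (Y - X) * Real.sin X * Real.sin Y
          = Real.sin X ^ 2 + Real.sin Y ^ 2 - Real.sin (Y - X) ^ 2 := by
        rw [Real.sin_sub, Real.cos_sub]; ring_nf; rw [cx, cy]; ring
      have e : ((n - 1) * (Real.cos Y * (n + 1) / Real.sin Y)
        - (m - 1) * (Real.cos X * (m + 1) / Real.sin X)
        - (n - m) * (Real.cos (Y - X) * ((n + 1) - (m + 1)) / Real.sin (Y - X)))
        = (m * (n - m) * Real.sin Y ^ 2 - (n * (n - m) * Real.sin X ^ 2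
          + (m * n - 1) * Real.sin (Y - X) ^ 2))
          / (Real.sin X * Real.sin Y * Real.sin (Y - X)) := by
        field_simp
        linear_combination (n^2-1)/2 * l2 - (m^2-1)/2 * l1 - (n-m)^2/2 * l3
      rw [e]
      exact div_neg_of_neg_of_pos (by linarith) (by positivity)
  have := anti (Set.left_mem_Icc.2 htp.le) (Set.right_mem_Icc.2 htp.le) htp
  simp only [f, mul_zero, add_zero, ← hxt, ← hyt] at this
  linarith

lemma uniq (n m x y x' y' : ℝ) (E : ℤ) (hm : 1 ≤ m) (hmn : m < n)
    (hx : 0 < x) (hxy : x < y) (hy : y < Real.pi)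
    (hx' : 0 < x') (hxy' : x' < y') (hy' : y' < Real.pi)
    (he : (n + 1) * x - (m + 1) * y = Real.pi * E)
    (he' : (n + 1) * x' - (m + 1) * y' = Real.pi * E)
    (hK : (n - 1) * Real.log (Real.sin y) - (m - 1) * Real.log (Real.sin x)
        - (n - m) * Real.log (Real.sin (y - x))
      = (n - 1) * Real.log (Real.sin y') - (m - 1) * Real.log (Real.sin x')
        - (n - m) * Real.log (Real.sin (y' - x'))) : x = x' ∧ y = y' := by
  have h : x = x' := le_antisymm
    (not_lt.1 (uniq_aux n m x' y' x y E hm hmn hx' hxy' hy' hx hxy hy he' he hK.symm))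
    (not_lt.1 (uniq_aux n m x y x' y' E hm hmn hx hxy hy hx' hxy' hy' he he' hK))
  refine ⟨h, ?_⟩
  subst h
  have : (m + 1) * (y - y') = 0 := by linarith
  rcases mul_eq_zero.1 this with h | h <;> linarith

lemma up_data (n m d N M : ℕ) (hm : 1 ≤ m) (hmn : m < n) (hN : n + 1 = d * N) (hM : m + 1 = d * M)
    (c : ℝ) (hc : c ≠ 0) (s : ℤ) (hs : (0 < c ∧ s = 1) ∨ (c < 0 ∧ s = 0)) (w : ℂ) (hw : w ≠ 0)
    (heq : w ^ n + (c : ℂ) * w ^ m + (starRingEnd ℂ) w = 0)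
    (hup : 0 < ((c : ℂ) * w ^ (m + 1)).im) :
    ∃ (x y : ℝ) (k : ℤ), 0 < x ∧ x < y ∧ y < Real.pi ∧
      ((n : ℝ) + 1) * x - ((m : ℝ) + 1) * y = Real.pi * ((d * k : ℤ) : ℝ) ∧
      (∃ t : ℤ, k = N * s + 2 * t) ∧
      ‖w‖ ^ (n - 1) * Real.sin (y - x) = Real.sin x ∧
      |c| * ‖w‖ ^ (m - 1) * Real.sin (y - x) = Real.sin y ∧
      w ^ (n + 1) = ((‖w‖ ^ (n + 1) : ℝ) : ℂ) * Complex.exp ((-y : ℝ) * Complex.I) ∧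
      (c : ℂ) * w ^ (m + 1) = ((|c| * ‖w‖ ^ (m + 1) : ℝ) : ℂ) *
        Complex.exp ((Real.pi - x : ℝ) * Complex.I) := by
  have hr : 0 < ‖w‖ := norm_pos_iff.2 hw
  have hca : 0 < |c| := abs_pos.2 hc
  set P := w ^ (n + 1) with hP
  set Q := (c : ℂ) * w ^ (m + 1) with hQ
  have hsum : P + Q + ((‖w‖ ^ 2 : ℝ) : ℂ) = 0 := by
    have h1 : (starRingEnd ℂ) w * w = ((‖w‖ ^ 2 : ℝ) : ℂ) := by
      rw [Complex.conj_mul']; push_cast; rfl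
    rw [← h1, hP, hQ]
    linear_combination w * heq
  have nP : ‖P‖ = ‖w‖ ^ (n + 1) := by rw [hP, norm_pow]
  have nQ : ‖Q‖ = |c| * ‖w‖ ^ (m + 1) := by
    rw [hQ, norm_mul, norm_pow, Complex.norm_real, Real.norm_eq_abs]
  have him : P.im = - Q.im := by
    have := congrArg Complex.im hsum
    simp only [Complex.add_im, Complex.ofReal_im, Complex.zero_im] at this
    linarith
  have hre : P.re + Q.re + ‖w‖ ^ 2 = 0 := by
    have := congrArg Complex.re hsum
    simpa only [Complex.add_re, Complex.ofReal_re, Complex.zero_re] using this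
  have aQ0 : 0 < Complex.arg Q := by
    rcases (Complex.arg_nonneg_iff.2 hup.le).lt_or_eq with h | h
    · exact h
    · have := (Complex.arg_eq_zero_iff.1 h.symm).2
      linarith
  have aQ1 : Complex.arg Q < Real.pi := Complex.arg_lt_pi_iff.2 (Or.inr hup.ne')
  have aP0 : Complex.arg P < 0 := Complex.arg_neg_iff.2 (by linarith)
  have aP1 := Complex.neg_pi_lt_arg P
  set x := Real.pi - Complex.arg Q with hx
  set y := - Complex.arg P with hy
  have ePe : P = ((‖w‖ ^ (n + 1) : ℝ) : ℂ) * Complex.exp ((-y : ℝ) * Complex.I) := by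
    rw [← nP, hy, neg_neg, Complex.norm_mul_exp_arg_mul_I]
  have eQe : Q = ((|c| * ‖w‖ ^ (m + 1) : ℝ) : ℂ) *
        Complex.exp ((Real.pi - x : ℝ) * Complex.I) := by
    rw [← nQ, hx, sub_sub_cancel, Complex.norm_mul_exp_arg_mul_I]
  have Pre : P.re = ‖w‖ ^ (n + 1) * Real.cos y := by
    rw [ePe, Complex.re_ofReal_mul, Complex.exp_ofReal_mul_I_re, Real.cos_neg]
  have Pim : P.im = - (‖w‖ ^ (n + 1) * Real.sin y) := by
    rw [ePe, Complex.im_ofReal_mul, Complex.exp_ofReal_mul_I_im, Real.sin_neg]; ring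
  have Qre : Q.re = - (|c| * ‖w‖ ^ (m + 1) * Real.cos x) := by
    rw [eQe, Complex.re_ofReal_mul, Complex.exp_ofReal_mul_I_re, Real.cos_pi_sub]; ring
  have Qim : Q.im = |c| * ‖w‖ ^ (m + 1) * Real.sin x := by
    rw [eQe, Complex.im_ofReal_mul, Complex.exp_ofReal_mul_I_im, Real.sin_pi_sub]
  have en : ‖w‖ ^ (n + 1) = ‖w‖ ^ 2 * ‖w‖ ^ (n - 1) := by
    rw [← pow_add]; congr 1; omega
  have em : ‖w‖ ^ (m + 1) = ‖w‖ ^ 2 * ‖w‖ ^ (m - 1) := by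
    rw [← pow_add]; congr 1; omega
  have t1 : ‖w‖ ^ (n - 1) * Real.cos y + 1 = |c| * ‖w‖ ^ (m - 1) * Real.cos x := by
    rw [Pre, Qre, en, em] at hre
    have : ‖w‖ ^ 2 * (‖w‖ ^ (n - 1) * Real.cos y + 1 - |c| * ‖w‖ ^ (m - 1) * Real.cos x) = 0 := by
      linarith
    rcases mul_eq_zero.1 this with h | h
    · exact absurd h (by positivity)
    · linarith
  have t2 : ‖w‖ ^ (n - 1) * Real.sin y = |c| * ‖w‖ ^ (m - 1) * Real.sin x := by
    rw [Pim, Qim, en, em] at him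
    have : ‖w‖ ^ 2 * (‖w‖ ^ (n - 1) * Real.sin y - |c| * ‖w‖ ^ (m - 1) * Real.sin x) = 0 := by
      linarith
    rcases mul_eq_zero.1 this with h | h
    · exact absurd h (by positivity)
    · linarith
  have u1 : ‖w‖ ^ (n - 1) * Real.sin (y - x) = Real.sin x := by
    rw [Real.sin_sub]
    linear_combination Real.cos x * t2 - Real.sin x * t1
  have u2 : |c| * ‖w‖ ^ (m - 1) * Real.sin (y - x) = Real.sin y := by
    rw [Real.sin_sub]
    linear_combination Real.cos y * t2 - Real.sin y * t1
  have x0 : 0 < x := by linarith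
  have xpi : x < Real.pi := by linarith
  have y0 : 0 < y := by linarith
  have ypi : y < Real.pi := by linarith
  have xy : x < y := by
    by_contra hc'
    have h1 : Real.sin (y - x) ≤ 0 :=
      Real.sin_nonpos_of_nonpos_of_neg_pi_le (by linarith) (by linarith)
    have h2 := Real.sin_pos_of_pos_of_lt_pi x0 xpi
    have h3 : 0 < ‖w‖ ^ (n - 1) := by positivity
    nlinarith
  -- the integers
  have hpol : w = (‖w‖ : ℂ) * Complex.exp (Complex.arg w * Complex.I) :=
    (Complex.norm_mul_exp_arg_mul_I w).symm
  set θ := Complex.arg w with hθ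
  have wpow : ∀ l : ℕ, w ^ l = ((‖w‖ ^ l : ℝ) : ℂ) * Complex.exp ((l * θ : ℝ) * Complex.I) := by
    intro l
    conv_lhs => rw [hpol]
    rw [mul_pow, ← Complex.exp_nat_mul]
    push_cast
    ring_nf
  obtain ⟨j, hj⟩ : ∃ j : ℤ, ((n : ℝ) + 1) * θ = -y + j * (2 * Real.pi) := by
    have h1 := wpow (n + 1)
    rw [← hP] at h1
    have h2 : Complex.exp ((((n + 1 : ℕ) : ℝ) * θ : ℝ) * Complex.I)
        = Complex.exp ((-y : ℝ) * Complex.I) := by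
      have h3 : ((‖w‖ ^ (n + 1) : ℝ) : ℂ) ≠ 0 := by
        exact_mod_cast (pow_pos hr _).ne'
      exact mul_left_cancel₀ h3 (h1.symm.trans ePe)
    obtain ⟨j, hj⟩ := Complex.exp_eq_exp_iff_exists_int.1 h2
    refine ⟨j, ?_⟩
    have := congrArg Complex.im hj
    simpa using this
  obtain ⟨k, hk⟩ : ∃ k : ℤ, ((m : ℝ) + 1) * θ = Real.pi * s - x + k * (2 * Real.pi) := by
    have h1 := wpow (m + 1)
    have h3 : ((‖w‖ ^ (m + 1) : ℝ) : ℂ) ≠ 0 := by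
      exact_mod_cast (pow_pos hr _).ne'
    have h4 : (c : ℂ) ≠ 0 := by exact_mod_cast hc
    have h5 := eQe
    rw [hQ, h1] at h5
    have h2 : Complex.exp ((((m + 1 : ℕ) : ℝ) * θ : ℝ) * Complex.I)
        = Complex.exp ((Real.pi * s - x : ℝ) * Complex.I) := by
      apply mul_left_cancel₀ (mul_ne_zero h4 h3)
      rw [mul_assoc, h5]
      rcases hs with ⟨hc1, rfl⟩ | ⟨hc1, rfl⟩
      · rw [abs_of_pos hc1]; simp
      · rw [abs_of_neg hc1]
        have : ((Real.pi - x : ℝ) : ℂ) * Complex.I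
          = ((Real.pi * (0 : ℤ) - x : ℝ) : ℂ) * Complex.I + Real.pi * Complex.I := by
          push_cast; ring
        rw [this, Complex.exp_add, Complex.exp_pi_mul_I]
        push_cast
        ring
    obtain ⟨j, hj⟩ := Complex.exp_eq_exp_iff_exists_int.1 h2
    refine ⟨j, ?_⟩
    have := congrArg Complex.im hj
    simpa using this
  have hN' : (n : ℝ) + 1 = d * N := by exact_mod_cast hN
  have hM' : (m : ℝ) + 1 = d * M := by exact_mod_cast hM
  refine ⟨x, y, N * s + 2 * (N * k - M * j), x0, xy, ypi, ?_, ⟨_, rfl⟩, u1, u2, ePe, eQe⟩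
  have hx' : x = Real.pi * s + k * (2 * Real.pi) - ((m : ℝ) + 1) * θ := by linarith
  have hy' : y = j * (2 * Real.pi) - ((n : ℝ) + 1) * θ := by linarith
  rw [hx', hy', hN', hM']
  push_cast
  ring

lemma up_uniq (n m : ℕ) (hm : 1 ≤ m) (hmn : m < n)
    (c : ℝ) (hc : c ≠ 0) (w w' : ℂ) (hw : w ≠ 0) (hw' : w' ≠ 0) (x y x' y' : ℝ) (E : ℤ)
    (hx : 0 < x) (hxy : x < y) (hy : y < Real.pi)
    (hx' : 0 < x') (hxy' : x' < y') (hy' : y' < Real.pi)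
    (he : ((n : ℝ) + 1) * x - ((m : ℝ) + 1) * y = Real.pi * E)
    (he' : ((n : ℝ) + 1) * x' - ((m : ℝ) + 1) * y' = Real.pi * E)
    (h1 : ‖w‖ ^ (n - 1) * Real.sin (y - x) = Real.sin x)
    (h2 : |c| * ‖w‖ ^ (m - 1) * Real.sin (y - x) = Real.sin y)
    (h1' : ‖w'‖ ^ (n - 1) * Real.sin (y' - x') = Real.sin x')
    (h2' : |c| * ‖w'‖ ^ (m - 1) * Real.sin (y' - x') = Real.sin y') :
    x = x' ∧ y = y' ∧ ‖w‖ = ‖w'‖ := by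
  have hK : ∀ (w : ℂ) (x y : ℝ), w ≠ 0 → 0 < x → x < y → y < Real.pi →
      ‖w‖ ^ (n - 1) * Real.sin (y - x) = Real.sin x →
      |c| * ‖w‖ ^ (m - 1) * Real.sin (y - x) = Real.sin y →
      ((n : ℝ) - 1) * Real.log (Real.sin y) - ((m : ℝ) - 1) * Real.log (Real.sin x)
        - ((n : ℝ) - m) * Real.log (Real.sin (y - x)) = ((n : ℝ) - 1) * Real.log |c| := by
    intro w x y hw hx hxy hy h1 h2
    have hr : 0 < ‖w‖ := norm_pos_iff.2 hw
    have hca : 0 < |c| := abs_pos.2 hc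
    have sw := Real.sin_pos_of_pos_of_lt_pi (sub_pos.2 hxy) (by linarith)
    rw [← h1, ← h2, Real.log_mul (by positivity) (by positivity),
      Real.log_mul (by positivity) (by positivity), Real.log_mul (by positivity) (by positivity),
      Real.log_pow, Real.log_pow, Nat.cast_sub (by omega), Nat.cast_sub (by omega)]
    push_cast
    ring
  have hm1 : (1 : ℝ) ≤ m := by exact_mod_cast hm
  have hmn1 : (m : ℝ) < n := by exact_mod_cast hmn
  obtain ⟨rfl, rfl⟩ := uniq n m x y x' y' E hm1 hmn1 hx hxy hy hx' hxy' hy' he he'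
    ((hK w x y hw hx hxy hy h1 h2).trans (hK w' x' y' hw' hx' hxy' hy' h1' h2').symm)
  refine ⟨rfl, rfl, ?_⟩
  have sw := Real.sin_pos_of_pos_of_lt_pi (sub_pos.2 hxy) (by linarith)
  have : ‖w‖ ^ (n - 1) = ‖w'‖ ^ (n - 1) := mul_right_cancel₀ sw.ne' (h1.trans h1'.symm)
  exact (pow_left_inj₀ (norm_nonneg _) (norm_nonneg _) (by omega)).1 this

lemma fiber_bound {α β : Type*} (S : Set α) (f : α → β) (T : Set β) (k d : ℕ)
    (hT : T.encard ≤ k) (hmaps : ∀ a ∈ S, f a ∈ T)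
    (hfib : ∀ b ∈ T, {a ∈ S | f a = b}.encard ≤ d) : S.encard ≤ ((d * k : ℕ) : ℕ∞) := by
  classical
  obtain ⟨Tf, Tc⟩ := Set.encard_le_coe_iff_finite_ncard_le.1 hT
  have hSf : S.Finite := by
    have : S ⊆ ⋃ b ∈ T, {a ∈ S | f a = b} := by
      intro a ha
      simp only [Set.mem_iUnion]
      exact ⟨f a, hmaps a ha, ha, rfl⟩
    refine Set.Finite.subset (Set.Finite.biUnion Tf fun b hb => ?_) this
    exact (Set.encard_le_coe_iff_finite_ncard_le.1 (hfib b hb)).1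
  rw [hSf.encard_eq_coe_toFinset_card]
  rw [Set.ncard_eq_toFinset_card _ Tf] at Tc
  have := Finset.card_le_mul_card_image_of_maps_to (f := f) (s := hSf.toFinset) (t := Tf.toFinset)
    (by simpa using hmaps) d (by
      intro b hb
      have h1 := (Set.encard_le_coe_iff_finite_ncard_le.1 (hfib b (by simpa using hb))).2
      have h2 : ((hSf.toFinset.filter (fun a => f a = b) : Finset α) : Set α)
        = {a ∈ S | f a = b} := by ext; simp
      rw [← h2, Set.ncard_coe_finset] at h1
      exact h1)
  exact_mod_cast this.trans (Nat.mul_le_mul_left d Tc)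

lemma root_bound (d : ℕ) (hd : 0 < d) (b : ℂ) : {a : ℂ | a ^ d = b}.encard ≤ d := by
  classical
  have : {a : ℂ | a ^ d = b} = ((Polynomial.nthRoots d b).toFinset : Set ℂ) := by
    ext a; simp [Polynomial.mem_nthRoots hd]
  rw [this, Set.encard_coe_eq_coe_finsetCard]
  exact_mod_cast (Multiset.toFinset_card_le _).trans (Polynomial.card_nthRoots d b)

lemma pow_gcd_eq (a b : ℂ) (p q : ℕ) (hb : b ≠ 0) (h1 : a ^ p = b ^ p) (h2 : a ^ q = b ^ q) :
    a ^ (Nat.gcd p q) = b ^ (Nat.gcd p q) := by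
  have e1 : (a / b) ^ p = 1 := by rw [div_pow, h1, div_self (pow_ne_zero _ hb)]
  have e2 : (a / b) ^ q = 1 := by rw [div_pow, h2, div_self (pow_ne_zero _ hb)]
  have : (a / b) ^ (Nat.gcd p q) = 1 := pow_gcd_eq_one.2 ⟨e1, e2⟩
  rw [div_pow, div_eq_one_iff_eq (pow_ne_zero _ hb)] at this
  exact this

lemma up_bound (n m d N M : ℕ) (hm : 1 ≤ m) (hmn : m < n) (hd : d = Nat.gcd (n + 1) (m + 1))
    (hN : n + 1 = d * N) (hM : m + 1 = d * M) (c : ℝ) (hc : c ≠ 0) :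
    {w : ℂ | w ≠ 0 ∧ w ^ n + (c : ℂ) * w ^ m + (starRingEnd ℂ) w = 0 ∧
      0 < ((c : ℂ) * w ^ (m + 1)).im}.encard ≤ ((d * (N / 2) : ℕ) : ℕ∞) := by
  classical
  have hd0 : 0 < d := by rw [hd]; exact Nat.gcd_pos_of_pos_left _ (by omega)
  obtain ⟨s, hs⟩ : ∃ s : ℤ, (0 < c ∧ s = 1) ∨ (c < 0 ∧ s = 0) := by
    rcases lt_or_gt_of_ne hc with h | h
    · exact ⟨0, Or.inr ⟨h, rfl⟩⟩
    · exact ⟨1, Or.inl ⟨h, rfl⟩⟩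
  set S := {w : ℂ | w ≠ 0 ∧ w ^ n + (c : ℂ) * w ^ m + (starRingEnd ℂ) w = 0 ∧
      0 < ((c : ℂ) * w ^ (m + 1)).im} with hS
  have data : ∀ w : ℂ, ∃ (k : ℤ), w ∈ S → ∃ (x y : ℝ), 0 < x ∧ x < y ∧ y < Real.pi ∧
      ((n : ℝ) + 1) * x - ((m : ℝ) + 1) * y = Real.pi * ((d * k : ℤ) : ℝ) ∧
      (∃ t : ℤ, k = N * s + 2 * t) ∧
      ‖w‖ ^ (n - 1) * Real.sin (y - x) = Real.sin x ∧
      |c| * ‖w‖ ^ (m - 1) * Real.sin (y - x) = Real.sin y ∧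
      w ^ (n + 1) = ((‖w‖ ^ (n + 1) : ℝ) : ℂ) * Complex.exp ((-y : ℝ) * Complex.I) ∧
      (c : ℂ) * w ^ (m + 1) = ((|c| * ‖w‖ ^ (m + 1) : ℝ) : ℂ) *
        Complex.exp ((Real.pi - x : ℝ) * Complex.I) := by
    intro w
    by_cases h : w ∈ S
    · obtain ⟨x, y, k, hk⟩ := up_data n m d N M hm hmn hN hM c hc s hs w h.1 h.2.1 h.2.2
      exact ⟨k, fun _ => ⟨x, y, hk⟩⟩
    · exact ⟨0, fun h' => absurd h' h⟩
  choose κ hκ using data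
  let T : Set ℤ := {k : ℤ | -(M : ℤ) < k ∧ k < (N : ℤ) - M ∧ ∃ t : ℤ, k = N * s + 2 * t}
  have hT : T.encard ≤ ((N / 2 : ℕ) : ℕ∞) := by
    obtain ⟨p, hp0, hp1, q, hq⟩ : ∃ p : ℤ, 0 ≤ p ∧ p ≤ 1 ∧ ∃ q : ℤ, N * s + M + p = 2 * q := by
      rcases Int.even_or_odd' ((N : ℤ) * s + M) with ⟨q, h | h⟩
      · exact ⟨0, by norm_num, by norm_num, q, by linarith⟩
      · exact ⟨1, by norm_num, by norm_num, q + 1, by linarith⟩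
    have hinj : Set.InjOn (fun k : ℤ => (k + M + p) / 2) T := by
      rintro a ⟨-, -, t, ht⟩ b ⟨-, -, t', ht'⟩ hab
      simp only at hab
      omega
    have hmap : Set.MapsTo (fun k : ℤ => (k + M + p) / 2) T
        ((Finset.Icc (1 : ℤ) ((N / 2 : ℕ) : ℤ) : Finset ℤ) : Set ℤ) := by
      rintro a ⟨h1, h2, t, ht⟩
      rw [Finset.coe_Icc, Set.mem_Icc]
      simp only
      push_cast
      omega
    have := Set.encard_le_encard_of_injOn hmap hinj
    rw [Set.encard_coe_eq_coe_finsetCard] at this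
    rw [Int.card_Icc, show (((N / 2 : ℕ) : ℤ) + 1 - 1).toNat = N / 2 by omega] at this
    exact this
  refine fiber_bound S κ T (N / 2) d hT ?_ ?_
  · intro w hw
    obtain ⟨x, y, x0, xy, ypi, he, ht, -⟩ := hκ w hw
    have pp := Real.pi_pos
    have hdr : (0 : ℝ) < d := by exact_mod_cast hd0
    have hN' : (n : ℝ) + 1 = d * N := by exact_mod_cast hN
    have hM' : (m : ℝ) + 1 = d * M := by exact_mod_cast hM
    have hmn' : (m : ℝ) < n := by exact_mod_cast hmn
    have hm0 : (0 : ℝ) ≤ m := by positivity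
    push_cast at he
    have a1 : ((m : ℝ) + 1) * y < ((m : ℝ) + 1) * Real.pi := by nlinarith
    have a2 : 0 < ((n : ℝ) + 1) * x := by nlinarith
    have a3 : ((m : ℝ) + 1) * x < ((m : ℝ) + 1) * y := by nlinarith
    have a4 : ((n : ℝ) - m) * x < ((n : ℝ) - m) * Real.pi := by nlinarith
    have b1 : -(M : ℝ) < κ w := by
      have : (Real.pi * d) * (-(M : ℝ)) < (Real.pi * d) * κ w := by
        rw [hM'] at a1 he; linarith
      exact lt_of_mul_lt_mul_left this (by positivity)
    have b2 : (κ w : ℝ) < N - M := by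
      have : (Real.pi * d) * κ w < (Real.pi * d) * (N - M) := by
        have e : (n : ℝ) - m = d * N - d * M := by linarith
        have : ((n : ℝ) + 1) * x - ((m : ℝ) + 1) * y < ((n : ℝ) - m) * Real.pi := by linarith
        rw [he, e] at this
        linarith
      exact lt_of_mul_lt_mul_left this (by positivity)
    exact ⟨by exact_mod_cast b1, by exact_mod_cast b2, ht⟩
  · intro b hb
    by_cases hne : ∃ w0 ∈ S, κ w0 = b
    · obtain ⟨w0, hw0, hb0⟩ := hne
      refine le_trans (Set.encard_le_encard ?_) (root_bound d hd0 (w0 ^ d))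
      rintro w ⟨hw, hwb⟩
      obtain ⟨x, y, x0, xy, ypi, he, ht, h1, h2, h3, h4⟩ := hκ w hw
      obtain ⟨x', y', x0', xy', ypi', he', ht', h1', h2', h3', h4'⟩ := hκ w0 hw0
      rw [hb0] at he'
      rw [hwb] at he
      obtain ⟨rfl, rfl, hn⟩ := up_uniq n m hm hmn c hc w w0 hw.1 hw0.1 x y x' y' _ x0 xy ypi
        x0' xy' ypi' he he' h1 h2 h1' h2'
      have hcc : (c : ℂ) ≠ 0 := by exact_mod_cast hc
      show w ^ d = w0 ^ d
      rw [hd]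
      apply pow_gcd_eq _ _ _ _ hw0.1
      · rw [h3, h3', hn]
      · apply mul_left_cancel₀ hcc
        rw [h4, h4', hn]
    · have : {a ∈ S | κ a = b} = ∅ := by
        ext a
        simp only [Set.mem_ofPred_eq, Set.mem_empty_iff_false, iff_false]
        exact fun h => hne ⟨a, h.1, h.2⟩
      rw [this]; simp

lemma roots_neg (p q : ℕ) (hp : 1 ≤ p) (b : ℝ) :
    {r : ℝ | 0 < r ∧ (-1) * r ^ (p + q) + b * r ^ q + 1 = 0}.encard ≤ ((1 : ℕ) : ℕ∞) := by
  have key : ∀ r r' : ℝ, 0 < r → (-1) * r ^ (p + q) + b * r ^ q + 1 = 0 →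
      (-1) * r' ^ (p + q) + b * r' ^ q + 1 = 0 → ¬ r < r' := by
    intro r r' hr h h' hlt
    rw [pow_add] at h h'
    have e1 : r ^ q * (r ^ p - b) = 1 := by linarith
    have e2 : r' ^ q * (r' ^ p - b) = 1 := by linarith
    have h1 : 0 < r ^ q := by positivity
    have h2 : 0 < r ^ p - b := by
      by_contra hc
      nlinarith
    have h3 : r ^ p < r' ^ p := pow_lt_pow_left₀ hlt hr.le (by omega)
    have h4 : r ^ q ≤ r' ^ q := pow_le_pow_left₀ hr.le hlt.le q
    nlinarith
  rw [Nat.cast_one, Set.encard_le_one_iff]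
  rintro r r' ⟨h1, h2⟩ ⟨h3, h4⟩
  exact le_antisymm (not_lt.1 (key r' r h3 h4 h2)) (not_lt.1 (key r r' h1 h2 h4))

lemma roots_pos_no_three (p q : ℕ) (hp : 1 ≤ p) (b : ℝ) (x y z : ℝ) (hx : 0 < x)
    (hxy : x < y) (hyz : y < z)
    (h1 : x ^ (p + q) + b * x ^ q + 1 = 0) (h2 : y ^ (p + q) + b * y ^ q + 1 = 0)
    (h3 : z ^ (p + q) + b * z ^ q + 1 = 0) : False := by
  let f : ℝ → ℝ := fun r => r ^ (p + q) + b * r ^ q + 1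
  let f' : ℝ → ℝ := fun r => ((p + q : ℕ) : ℝ) * r ^ (p + q - 1) + b * ((q : ℝ) * r ^ (q - 1))
  have hd : ∀ r, HasDerivAt f (f' r) r := fun r =>
    ((hasDerivAt_pow (p + q) r).add ((hasDerivAt_pow q r).const_mul b)).add_const 1
  have hcont : Continuous f := by fun_prop
  obtain ⟨s, hs, hs0⟩ := exists_hasDerivAt_eq_zero hxy hcont.continuousOn (h1.trans h2.symm)
    (fun r _ => hd r)
  obtain ⟨t, ht, ht0⟩ := exists_hasDerivAt_eq_zero hyz hcont.continuousOn (h2.trans h3.symm)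
    (fun r _ => hd r)
  have key : ∀ r, 0 < r → f' r = 0 → ((p + q : ℕ) : ℝ) * r ^ p = - (b * q) := by
    intro r hr h
    have h1 : r ^ (p + q - 1) * r = r ^ p * r ^ q := by
      rw [← pow_succ, ← pow_add]; congr 1; omega
    have h2 : (q : ℝ) * r ^ (q - 1) * r = q * r ^ q := by
      rcases q with _ | q
      · simp
      · rw [mul_assoc, ← pow_succ]; rfl
    have h3 : r ^ q * (((p + q : ℕ) : ℝ) * r ^ p + b * q) = 0 := by
      have : f' r * r = 0 := by rw [h, zero_mul]
      simp only [f'] at this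
      linear_combination this - ((p + q : ℕ) : ℝ) * h1 - b * h2
    rcases mul_eq_zero.1 h3 with h4 | h4
    · exact absurd h4 (by positivity)
    · linarith
  have s0 : 0 < s := hx.trans hs.1
  have t0 : 0 < t := s0.trans (hs.2.trans ht.1)
  have e := (key s s0 hs0).trans (key t t0 ht0).symm
  have hpq : ((p + q : ℕ) : ℝ) ≠ 0 := by
    have : p + q ≠ 0 := by omega
    exact_mod_cast this
  have e2 := mul_left_cancel₀ hpq e
  have e3 : s ^ p < t ^ p := pow_lt_pow_left₀ (hs.2.trans ht.1) s0.le (by omega)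
  linarith

lemma roots_pos (p q : ℕ) (hp : 1 ≤ p) (b : ℝ) :
    {r : ℝ | 0 < r ∧ 1 * r ^ (p + q) + b * r ^ q + 1 = 0}.encard ≤ ((2 : ℕ) : ℕ∞) := by
  by_contra hc
  rw [not_le] at hc
  have h3 : (3 : ℕ∞) ≤ {r : ℝ | 0 < r ∧ 1 * r ^ (p + q) + b * r ^ q + 1 = 0}.encard := by
    have := Order.add_one_le_of_lt hc
    exact this
  obtain ⟨t, ht, hcard⟩ := Set.exists_subset_encard_eq h3
  obtain ⟨x, y, z, hxy, hxz, hyz, rfl⟩ := Set.encard_eq_three.1 hcard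
  obtain ⟨x0, hx⟩ := ht (show x ∈ ({x, y, z} : Set ℝ) by simp)
  obtain ⟨y0, hy⟩ := ht (show y ∈ ({x, y, z} : Set ℝ) by simp)
  obtain ⟨z0, hz⟩ := ht (show z ∈ ({x, y, z} : Set ℝ) by simp)
  rw [one_mul] at hx hy hz
  have key := roots_pos_no_three p q hp b
  rcases lt_or_gt_of_ne hxy with h1 | h1 <;> rcases lt_or_gt_of_ne hxz with h2 | h2 <;>
    rcases lt_or_gt_of_ne hyz with h3 | h3
  · exact key x y z x0 h1 h3 hx hy hz
  · exact key x z y x0 h2 h3 hx hz hy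
  · linarith
  · exact key z x y z0 h2 h1 hz hx hy
  · exact key y x z y0 h1 h2 hy hx hz
  · linarith
  · exact key y z x y0 h3 h2 hy hz hx
  · exact key z y x z0 h3 h1 hz hy hx

lemma roots_none (p q : ℕ) (b : ℝ) (hb : 0 ≤ b) :
    {r : ℝ | 0 < r ∧ 1 * r ^ (p + q) + b * r ^ q + 1 = 0}.encard ≤ ((0 : ℕ) : ℕ∞) := by
  have : {r : ℝ | 0 < r ∧ 1 * r ^ (p + q) + b * r ^ q + 1 = 0} = ∅ := by
    ext r
    simp only [Set.mem_ofPred_eq, Set.mem_empty_iff_false, iff_false]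
    rintro ⟨h1, h2⟩
    have : 0 < r ^ (p + q) := by positivity
    have : 0 ≤ b * r ^ q := by positivity
    linarith
  rw [this]; simp

lemma deg_class (n m d N M : ℕ) (hm : 1 ≤ m) (hmn : m < n) (hd0 : 0 < d)
    (hN : n + 1 = d * N) (hM : m + 1 = d * M) (c ε : ℝ) (k : ℕ)
    (hk : {r : ℝ | 0 < r ∧ ε ^ N * r ^ ((n - m) + (m - 1)) + (ε ^ M * c) * r ^ (m - 1) + 1 = 0}.encard
      ≤ (k : ℕ∞)) :
    {w : ℂ | w ≠ 0 ∧ w ^ n + (c : ℂ) * w ^ m + (starRingEnd ℂ) w = 0 ∧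
      w ^ d = (ε : ℂ) * (‖w‖ : ℂ) ^ d}.encard ≤ ((d * k : ℕ) : ℕ∞) := by
  refine fiber_bound _ (fun w => ‖w‖) _ k d hk ?_ ?_
  · rintro w ⟨hw, heq, he⟩
    have hr : 0 < ‖w‖ := norm_pos_iff.2 hw
    refine ⟨hr, ?_⟩
    have h1 : (starRingEnd ℂ) w * w = (‖w‖ : ℂ) ^ 2 := Complex.conj_mul' w
    have h2 : w ^ (n + 1) + c * w ^ (m + 1) + (‖w‖ : ℂ) ^ 2 = 0 := by
      rw [← h1]; linear_combination w * heq
    rw [hN, hM, pow_mul, pow_mul, he, mul_pow, mul_pow, ← pow_mul, ← pow_mul, ← hN, ← hM] at h2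
    have h3 : ε ^ N * ‖w‖ ^ (n + 1) + c * (ε ^ M * ‖w‖ ^ (m + 1)) + ‖w‖ ^ 2 = 0 := by
      exact_mod_cast h2
    have en : ‖w‖ ^ (n + 1) = ‖w‖ ^ 2 * ‖w‖ ^ ((n - m) + (m - 1)) := by
      rw [← pow_add]; congr 1; omega
    have em : ‖w‖ ^ (m + 1) = ‖w‖ ^ 2 * ‖w‖ ^ (m - 1) := by
      rw [← pow_add]; congr 1; omega
    rw [en, em] at h3
    have h4 : ‖w‖ ^ 2 * (ε ^ N * ‖w‖ ^ ((n - m) + (m - 1)) + (ε ^ M * c) * ‖w‖ ^ (m - 1) + 1)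
        = 0 := by linarith
    rcases mul_eq_zero.1 h4 with h | h
    · exact absurd h (by positivity)
    · exact h
  · intro b _
    refine le_trans (Set.encard_le_encard ?_) (root_bound d hd0 ((ε : ℂ) * (b : ℂ) ^ d))
    rintro w ⟨⟨-, -, he⟩, hb⟩
    rw [← hb]
    exact he

lemma deg_cover (n m d : ℕ) (hd : d = Nat.gcd (n + 1) (m + 1)) (c : ℝ) (hc : c ≠ 0) (w : ℂ)
    (hw : w ≠ 0) (heq : w ^ n + (c : ℂ) * w ^ m + (starRingEnd ℂ) w = 0)
    (him : ((c : ℂ) * w ^ (m + 1)).im = 0) :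
    w ^ d = ((1 : ℝ) : ℂ) * (‖w‖ : ℂ) ^ d ∨ w ^ d = ((-1 : ℝ) : ℂ) * (‖w‖ : ℂ) ^ d := by
  have hr : 0 < ‖w‖ := norm_pos_iff.2 hw
  have h1 : (starRingEnd ℂ) w * w = ((‖w‖ ^ 2 : ℝ) : ℂ) := by
    rw [Complex.conj_mul']; push_cast; rfl
  have h2 : w ^ (n + 1) + c * w ^ (m + 1) + ((‖w‖ ^ 2 : ℝ) : ℂ) = 0 := by
    rw [← h1]; linear_combination w * heq
  have i1 : (w ^ (m + 1)).im = 0 := by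
    rw [Complex.im_ofReal_mul] at him
    exact (mul_eq_zero.1 him).resolve_left hc
  have i2 : (w ^ (n + 1)).im = 0 := by
    have := congrArg Complex.im h2
    simp only [Complex.add_im, Complex.ofReal_im, Complex.zero_im] at this
    linarith
  have key : ∀ l : ℕ, (w ^ l).im = 0 → (w ^ 2) ^ l = ((‖w‖ : ℂ) ^ 2) ^ l := by
    intro l hl
    have e1 : (starRingEnd ℂ) (w ^ l) = w ^ l := Complex.conj_eq_iff_im.2 hl
    have e2 := Complex.conj_mul' (w ^ l)
    rw [e1, norm_pow] at e2
    push_cast at e2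
    rw [← pow_mul, ← pow_mul, mul_comm 2 l, pow_mul, pow_mul, sq, e2]
  have hn0 : ((‖w‖ : ℂ) ^ 2) ≠ 0 := by
    have : (‖w‖ : ℂ) ≠ 0 := by exact_mod_cast hr.ne'
    exact pow_ne_zero _ this
  have := pow_gcd_eq (w ^ 2) ((‖w‖ : ℂ) ^ 2) (n + 1) (m + 1) hn0 (key _ i2) (key _ i1)
  rw [← hd, ← pow_mul, ← pow_mul, mul_comm 2 d, pow_mul, pow_mul] at this
  rcases sq_eq_sq_iff_eq_or_eq_neg.1 this with h | h
  · left; rw [h]; simp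
  · right; rw [h]; simp

lemma union_bound {α : Type*} (S T U : Set α) (a b : ℕ) (h : S ⊆ T ∪ U)
    (hT : T.encard ≤ (a : ℕ∞)) (hU : U.encard ≤ (b : ℕ∞)) : S.encard ≤ ((a + b : ℕ) : ℕ∞) := by
  refine (Set.encard_le_encard h).trans ((Set.encard_union_le T U).trans ?_)
  push_cast
  exact add_le_add hT hU

lemma deg_bound (n m d N M : ℕ) (hm : 1 ≤ m) (hmn : m < n) (hd : d = Nat.gcd (n + 1) (m + 1))
    (hN : n + 1 = d * N) (hM : m + 1 = d * M) (hNM : Nat.Coprime N M) (c : ℝ) (hc : c ≠ 0) :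
    {w : ℂ | w ≠ 0 ∧ w ^ n + (c : ℂ) * w ^ m + (starRingEnd ℂ) w = 0 ∧
      ((c : ℂ) * w ^ (m + 1)).im = 0}.encard ≤ ((2 * d + d * (N % 2) : ℕ) : ℕ∞) := by
  have hd0 : 0 < d := by rw [hd]; exact Nat.gcd_pos_of_pos_left _ (by omega)
  have gen : ∀ k₁ k₂ : ℕ,
      {r : ℝ | 0 < r ∧ (1 : ℝ) ^ N * r ^ ((n - m) + (m - 1)) + ((1 : ℝ) ^ M * c) * r ^ (m - 1) + 1
        = 0}.encard ≤ (k₁ : ℕ∞) →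
      {r : ℝ | 0 < r ∧ (-1 : ℝ) ^ N * r ^ ((n - m) + (m - 1)) + ((-1 : ℝ) ^ M * c) * r ^ (m - 1) + 1
        = 0}.encard ≤ (k₂ : ℕ∞) →
      {w : ℂ | w ≠ 0 ∧ w ^ n + (c : ℂ) * w ^ m + (starRingEnd ℂ) w = 0 ∧
        ((c : ℂ) * w ^ (m + 1)).im = 0}.encard ≤ ((d * k₁ + d * k₂ : ℕ) : ℕ∞) := by
    intro k₁ k₂ h1 h2
    refine union_bound _ _ _ _ _ ?_ (deg_class n m d N M hm hmn hd0 hN hM c 1 k₁ h1)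
      (deg_class n m d N M hm hmn hd0 hN hM c (-1) k₂ h2)
    rintro w ⟨hw, heq, him⟩
    rcases deg_cover n m d hd c hc w hw heq him with h | h
    · exact Or.inl ⟨hw, heq, h⟩
    · exact Or.inr ⟨hw, heq, h⟩
  have hp : 1 ≤ n - m := by omega
  rcases Nat.even_or_odd N with hev | hod
  · have hMo : Odd M := by
      rw [← Nat.not_even_iff_odd]
      intro hMe
      have := Nat.dvd_gcd hev.two_dvd hMe.two_dvd
      rw [hNM] at this
      omega
    rw [hev.neg_one_pow, hMo.neg_one_pow, one_pow, one_pow, one_mul] at gen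
    rw [Nat.even_iff.1 hev]
    rcases lt_or_gt_of_ne hc with h | h
    · have := gen 2 0 (roots_pos _ _ hp c) (roots_none _ _ _ (by linarith))
      convert this using 2
      ring
    · have := gen 0 2 (roots_none _ _ _ (by linarith)) (roots_pos _ _ hp _)
      convert this using 2
      ring
  · rw [hod.neg_one_pow, one_pow, one_pow] at gen
    rw [Nat.odd_iff.1 hod]
    have := gen 2 1 (roots_pos _ _ hp _) (roots_neg _ _ hp _)
    convert this using 2
    ring

lemma total_bound (n m : ℕ) (hm : 1 ≤ m) (hmn : m < n) (c : ℝ) (hc : c ≠ 0) :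
    {w : ℂ | w ^ n + (c : ℂ) * w ^ m + (starRingEnd ℂ) w = 0}.encard
      ≤ ((n + 2 + 2 * Nat.gcd (n + 1) (m + 1) : ℕ) : ℕ∞) := by
  obtain ⟨d, hd⟩ : ∃ d, d = Nat.gcd (n + 1) (m + 1) := ⟨_, rfl⟩
  have hd0 : 0 < d := by rw [hd]; exact Nat.gcd_pos_of_pos_left _ (by omega)
  obtain ⟨N, hN⟩ : d ∣ n + 1 := by rw [hd]; exact Nat.gcd_dvd_left _ _
  obtain ⟨M, hM⟩ : d ∣ m + 1 := by rw [hd]; exact Nat.gcd_dvd_right _ _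
  have hNM : Nat.Coprime N M := by
    have h : d = d * Nat.gcd N M := by
      conv_lhs => rw [hd, hN, hM, Nat.gcd_mul_left]
    exact Nat.eq_of_mul_eq_mul_left hd0 (by rw [← h, mul_one])
  have hup := up_bound n m d N M hm hmn hd hN hM c hc
  have hdeg := deg_bound n m d N M hm hmn hd hN hM hNM c hc
  have hdown : {w : ℂ | w ≠ 0 ∧ w ^ n + (c : ℂ) * w ^ m + (starRingEnd ℂ) w = 0 ∧
      ((c : ℂ) * w ^ (m + 1)).im < 0}.encard ≤ ((d * (N / 2) : ℕ) : ℕ∞) := by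
    refine le_trans (Set.encard_le_encard_of_injOn (f := starRingEnd ℂ) ?_
      (RingHom.injective _).injOn) hup
    rintro w ⟨hw, heq, him⟩
    refine ⟨by simpa using hw, ?_, ?_⟩
    · have := congrArg (starRingEnd ℂ) heq
      simpa using this
    · have : (c : ℂ) * (starRingEnd ℂ) w ^ (m + 1) = (starRingEnd ℂ) ((c : ℂ) * w ^ (m + 1)) := by
        simp
      rw [this, Complex.conj_im]
      linarith
  have h0 : ({0} : Set ℂ).encard ≤ ((1 : ℕ) : ℕ∞) := by simp
  have h1 := union_bound _ _ _ _ _ subset_rfl hup hdown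
  have h2 := union_bound _ _ _ _ _ subset_rfl h1 hdeg
  have h3 := union_bound {w : ℂ | w ^ n + (c : ℂ) * w ^ m + (starRingEnd ℂ) w = 0} _ _ _ _ ?_ h2 h0
  · refine h3.trans ?_
    rw [← hd]
    have e : d * (N / 2) + d * (N / 2) + (2 * d + d * (N % 2)) + 1 = n + 2 + 2 * d := by
      have h := Nat.div_add_mod N 2
      have : d * (2 * (N / 2) + N % 2) = n + 1 := by rw [h, hN]
      rw [Nat.mul_add] at this
      have h' : d * (2 * (N / 2)) = d * (N / 2) + d * (N / 2) := by ring
      omega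
    rw [e]
  · intro w heq
    by_cases hw : w = 0
    · right; exact hw
    · left
      rcases lt_trichotomy (((c : ℂ) * w ^ (m + 1)).im) 0 with h | h | h
      · exact Or.inl (Or.inr ⟨hw, heq, h⟩)
      · exact Or.inr ⟨hw, heq, h⟩
      · exact Or.inl (Or.inl ⟨hw, heq, h⟩)

lemma zero_case (n m : ℕ) (hm : 1 ≤ m) (hmn : m < n) :
    {w : ℂ | w ^ n + ((0 : ℝ) : ℂ) * w ^ m + (starRingEnd ℂ) w = 0}.encard
      ≤ ((n + 2 : ℕ) : ℕ∞) := by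
  have h0 : ({0} : Set ℂ).encard ≤ ((1 : ℕ) : ℕ∞) := by simp
  refine union_bound _ _ _ (n + 1) 1 ?_ (root_bound (n + 1) (by omega) (-1)) h0
  intro w heq
  have heq : w ^ n + ((0 : ℝ) : ℂ) * w ^ m + (starRingEnd ℂ) w = 0 := heq
  by_cases hw : w = 0
  · right; exact hw
  · left
    have hr : 0 < ‖w‖ := norm_pos_iff.2 hw
    have h1 : w ^ n = - (starRingEnd ℂ) w := by
      rw [Complex.ofReal_zero] at heq; linear_combination heq
    have h2 : ‖w‖ ^ (n - 1) * ‖w‖ = 1 * ‖w‖ := by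
      have := congrArg norm h1
      rw [norm_pow, norm_neg, Complex.norm_conj] at this
      rw [← pow_succ, one_mul, Nat.sub_add_cancel (by omega), this]
    have h3 := mul_right_cancel₀ hr.ne' h2
    have h4 : ‖w‖ = 1 := (pow_eq_one_iff_of_nonneg hr.le (by omega)).1 h3
    show w ^ (n + 1) = -1
    rw [pow_succ, h1, neg_mul, Complex.conj_mul', h4]
    simp

lemma case_two (c : ℝ) :
    {w : ℂ | w ^ 2 + (c : ℂ) * w ^ 1 + (starRingEnd ℂ) w = 0}.encard ≤ ((4 : ℕ) : ℕ∞) := by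
  classical
  let x0 : ℝ := (1 - c) / 2
  let y0 : ℝ := Real.sqrt (x0 ^ 2 + (c + 1) * x0)
  have : {w : ℂ | w ^ 2 + (c : ℂ) * w ^ 1 + (starRingEnd ℂ) w = 0} ⊆
      (({⟨0, 0⟩, ⟨-(c + 1), 0⟩, ⟨x0, y0⟩, ⟨x0, -y0⟩} : Finset ℂ) : Set ℂ) := by
    rintro ⟨x, y⟩ h
    have h : (⟨x, y⟩ : ℂ) ^ 2 + (c : ℂ) * (⟨x, y⟩ : ℂ) ^ 1 + (starRingEnd ℂ) ⟨x, y⟩ = 0 := h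
    have hre := congrArg Complex.re h
    have him := congrArg Complex.im h
    simp [pow_succ] at hre him
    simp only [Finset.coe_insert, Finset.coe_singleton, Set.mem_insert_iff,
      Set.mem_singleton_iff, Complex.mk.injEq]
    have e : y * (2 * x + c - 1) = 0 := by linarith
    rcases mul_eq_zero.1 e with h | h
    · have : x * (x + (c + 1)) = 0 := by rw [h] at hre; linarith
      rcases mul_eq_zero.1 this with h' | h'
      · left; exact ⟨h', h⟩
      · right; left; exact ⟨by linarith, h⟩
    · have hx : x = x0 := by simp only [x0]; linarith
      have hy : y ^ 2 = x0 ^ 2 + (c + 1) * x0 := by rw [← hx]; linarith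
      have hy2 : y ^ 2 = y0 ^ 2 := by
        simp only [y0]; rw [Real.sq_sqrt (by rw [← hy]; positivity), hy]
      rcases sq_eq_sq_iff_eq_or_eq_neg.1 hy2 with h' | h'
      · right; right; left; exact ⟨hx, h'⟩
      · right; right; right; exact ⟨hx, h'⟩
  refine (Set.encard_le_encard this).trans ?_
  rw [Set.encard_coe_eq_coe_finsetCard]
  exact_mod_cast Finset.card_le_four

lemma case_three (c : ℝ) :
    {w : ℂ | w ^ 3 + (c : ℂ) * w ^ 1 + (starRingEnd ℂ) w = 0}.encard ≤ ((7 : ℕ) : ℕ∞) := by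
  classical
  let x0 : ℝ := Real.sqrt ((2 - c) / 4)
  let y0 : ℝ := Real.sqrt ((c + 2) / 4)
  let a : ℝ := if c < 0 then Real.sqrt (-(c + 1)) else 0
  let b : ℝ := if c < 0 then 0 else Real.sqrt (c - 1)
  have : {w : ℂ | w ^ 3 + (c : ℂ) * w ^ 1 + (starRingEnd ℂ) w = 0} ⊆
      ((insert ⟨0, 0⟩ ({⟨a, b⟩, ⟨-a, -b⟩, ⟨x0, y0⟩, ⟨x0, -y0⟩, ⟨-x0, y0⟩, ⟨-x0, -y0⟩} : Finset ℂ)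
        : Finset ℂ) : Set ℂ) := by
    rintro ⟨x, y⟩ h
    have h : (⟨x, y⟩ : ℂ) ^ 3 + (c : ℂ) * (⟨x, y⟩ : ℂ) ^ 1 + (starRingEnd ℂ) ⟨x, y⟩ = 0 := h
    have hre := congrArg Complex.re h
    have him := congrArg Complex.im h
    simp [pow_succ] at hre him
    simp only [Finset.coe_insert, Finset.coe_singleton, Set.mem_insert_iff,
      Set.mem_singleton_iff, Complex.mk.injEq]
    have e1 : x * (x ^ 2 - 3 * y ^ 2 + c + 1) = 0 := by linarith
    have e2 : y * (3 * x ^ 2 - y ^ 2 + c - 1) = 0 := by linarith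
    rcases mul_eq_zero.1 e1 with h1 | h1 <;> rcases mul_eq_zero.1 e2 with h2 | h2
    · left; exact ⟨h1, h2⟩
    · have hc : ¬ c < 0 := by rw [h1] at h2; nlinarith
      have ha : a = 0 := by simp only [a]; rw [if_neg hc]
      have hb : y ^ 2 = b ^ 2 := by
        simp only [b]; rw [if_neg hc, Real.sq_sqrt (by rw [h1] at h2; nlinarith)]
        rw [h1] at h2; linarith
      rcases sq_eq_sq_iff_eq_or_eq_neg.1 hb with h' | h'
      · right; left; exact ⟨by rw [h1, ha], h'⟩
      · right; right; left; exact ⟨by rw [h1, ha, neg_zero], h'⟩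
    · have hc : c < 0 := by rw [h2] at h1; nlinarith
      have hb : b = 0 := by simp only [b]; rw [if_pos hc]
      have ha : x ^ 2 = a ^ 2 := by
        simp only [a]; rw [if_pos hc, Real.sq_sqrt (by rw [h2] at h1; nlinarith)]
        rw [h2] at h1; linarith
      rcases sq_eq_sq_iff_eq_or_eq_neg.1 ha with h' | h'
      · right; left; exact ⟨h', by rw [h2, hb]⟩
      · right; right; left; exact ⟨h', by rw [h2, hb, neg_zero]⟩
    · have hx : x ^ 2 = x0 ^ 2 := by
        simp only [x0]; rw [Real.sq_sqrt (by nlinarith)]; linarith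
      have hy : y ^ 2 = y0 ^ 2 := by
        simp only [y0]; rw [Real.sq_sqrt (by nlinarith)]; linarith
      rcases sq_eq_sq_iff_eq_or_eq_neg.1 hx with h' | h' <;>
        rcases sq_eq_sq_iff_eq_or_eq_neg.1 hy with h'' | h'' <;> simp [h', h'']
  refine (Set.encard_le_encard this).trans ?_
  rw [Set.encard_coe_eq_coe_finsetCard]
  exact_mod_cast (Finset.card_insert_le _ _).trans (Nat.add_le_add_right Finset.card_le_six 1)

lemma all_bound (n m : ℕ) (hm : 1 ≤ m) (hmn : m < n) (c : ℝ) :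
    {w : ℂ | w ^ n + (c : ℂ) * w ^ m + (starRingEnd ℂ) w = 0}.encard
      ≤ ((3 * n - 2 : ℕ) : ℕ∞) := by
  by_cases hc : c = 0
  · subst hc
    refine (zero_case n m hm hmn).trans ?_
    exact_mod_cast (by omega : n + 2 ≤ 3 * n - 2)
  by_cases h2 : n = 2
  · have : m = 1 := by omega
    subst h2 this
    exact case_two c
  by_cases h3 : n = 3 ∧ m = 1
  · obtain ⟨rfl, rfl⟩ := h3
    exact case_three c
  refine (total_bound n m hm hmn c hc).trans ?_
  have hd : Nat.gcd (n + 1) (m + 1) ≤ n - 2 := by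
    by_cases h1 : m = 1
    · have := Nat.le_of_dvd (by omega) (Nat.gcd_dvd_right (n + 1) (m + 1))
      omega
    · have h4 : Nat.gcd (n + 1) (m + 1) ∣ n - m := by
        have := Nat.dvd_sub (Nat.gcd_dvd_left (n + 1) (m + 1)) (Nat.gcd_dvd_right (n + 1) (m + 1))
        rwa [show n + 1 - (m + 1) = n - m by omega] at this
      have := Nat.le_of_dvd (by omega) h4
      omega
  exact_mod_cast (by omega : n + 2 + 2 * Nat.gcd (n + 1) (m + 1) ≤ 3 * n - 2)

/-- The harmonic quadrinomial with `b = 0`, namely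
`q₀(z) = conj(z)^n + c conj(z)^m + z`, has at most `3n - 2` zeros. -/
theorem stmt_2 (n m : ℕ) (hm : 1 ≤ m) (hmn : m < n) (c : ℝ) :
    {z : ℂ | ((starRingEnd ℂ) z) ^ n + (c : ℂ) * ((starRingEnd ℂ) z) ^ m + z = 0}.Finite ∧
    {z : ℂ | ((starRingEnd ℂ) z) ^ n + (c : ℂ) * ((starRingEnd ℂ) z) ^ m + z = 0}.ncard ≤ 3 * n - 2 := by
  apply Set.encard_le_coe_iff_finite_ncard_le.1
  refine le_trans (Set.encard_le_encard_of_injOn (f := starRingEnd ℂ) ?_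
    (RingHom.injective _).injOn) (all_bound n m hm hmn c)
  intro z hz
  have hz : ((starRingEnd ℂ) z) ^ n + (c : ℂ) * ((starRingEnd ℂ) z) ^ m + z = 0 := hz
  show ((starRingEnd ℂ) z) ^ n + (c : ℂ) * ((starRingEnd ℂ) z) ^ m
    + (starRingEnd ℂ) ((starRingEnd ℂ) z) = 0
  rw [Complex.conj_conj]
  exact hz
end

section
/- Let p be a complex polynomial with deg p = n > 1. Then the complex-valued harmonic function f(z) = z − conj(p(z)) has at most 3n − 2 zeros: the set { z ∈ ℂ : z = conj(p(z)) } is finite and contains at most 3n − 2 points. -/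
namespace KS
open Polynomial Metric Filter Topology

theorem lift_disc (P : ℂ[X]) (R : ℝ) (hR : ∀ z : ℂ, ‖z‖ = R → R < ‖P.eval z‖)
    (r : ℝ) (hr : 0 < r) (φ : ℂ → ℂ) (hφ : DifferentiableOn ℂ φ (ball 0 r))
    (hφR : ∀ ζ ∈ ball (0:ℂ) r, ‖φ ζ‖ < R)
    (hcrit : ∀ c : ℂ, ‖c‖ < R → P.derivative.eval c = 0 → ∀ ζ ∈ ball (0:ℂ) r, φ ζ ≠ P.eval c)
    (z0 : ℂ) (hz0 : ‖z0‖ < R) (hPz0 : P.eval z0 = φ 0) :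
    ∃ H : ℂ → ℂ, DifferentiableOn ℂ H (ball 0 r) ∧
      (∀ ζ ∈ ball (0:ℂ) r, ‖H ζ‖ < R ∧ P.eval (H ζ) = φ ζ) ∧ H 0 = z0 := by
  classical
  let E := closedBall (0:ℂ) R
  let f : E → ℂ := (fun z : ℂ => P.eval z) ∘ Subtype.val
  let s : Set ℂ := φ '' (ball 0 r)
  have hfc : Continuous f := P.continuous.comp continuous_subtype_val
  have hintr : ∀ e : E, f e ∈ s → ‖(e:ℂ)‖ < R ∧ P.derivative.eval (e:ℂ) ≠ 0 := by
    rintro ⟨e, he⟩ ⟨ζ, hζ, h⟩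
    have h1 : ‖e‖ ≤ R := by simpa [E] using he
    have h2 : ‖e‖ < R := by
      rcases h1.lt_or_eq with h3 | h3
      · exact h3
      · exfalso
        have h4 := hR e h3
        have h5 := hφR ζ hζ
        rw [h] at h5
        exact lt_asymm h4 h5
    exact ⟨h2, fun h3 => hcrit e h2 h3 ζ hζ h⟩
  have hval : IsLocalHomeomorphOn (Subtype.val : E → ℂ) (f ⁻¹' s) := by
    rw [isLocalHomeomorphOn_iff_isOpenEmbedding_restrict]
    intro e he
    have hlt := (hintr e he).1
    refine ⟨Subtype.val ⁻¹' (ball (0:ℂ) R), ?_, ?_⟩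
    · exact (isOpen_ball.preimage continuous_subtype_val).mem_nhds (by simpa using hlt)
    · refine ⟨?_, ?_⟩
      · exact IsEmbedding.subtypeVal.comp IsEmbedding.subtypeVal
      · have : Set.range (Set.domRestrict (Subtype.val ⁻¹' (ball (0:ℂ) R)) (Subtype.val : E → ℂ)) = ball 0 R := by
          ext x
          constructor
          · rintro ⟨⟨y, hy⟩, rfl⟩
            exact hy
          · intro hx
            exact ⟨⟨⟨x, ball_subset_closedBall hx⟩, hx⟩, rfl⟩
        rw [this]
        exact isOpen_ball
  have hP : IsLocalHomeomorphOn (fun z : ℂ => P.eval z) {z | P.derivative.eval z ≠ 0} := by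
    intro x hx
    exact ⟨_, ((P.hasStrictDerivAt x).hasStrictFDerivAt_equiv hx).mem_toOpenPartialHomeomorph_source,
      by simp⟩
  have hloc : IsLocalHomeomorphOn f (f ⁻¹' s) := hP.comp hval (fun e he => (hintr e he).2)
  have hcov : IsCoveringMapOn f s := IsCoveringMapOn.of_isLocalHomeomorphOn hfc hloc
  have h0 : (0:ℂ) ∈ ball (0:ℂ) r := by simpa using hr
  have : ContractibleSpace (ball (0:ℂ) r) := (convex_ball _ _).contractibleSpace ⟨0, h0⟩
  have : LocallyPathConnectedSpace (ball (0:ℂ) r) := isOpen_ball.locallyPathConnectedSpace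
  obtain ⟨F, ⟨hF0, hF⟩, -⟩ := hcov.existsUnique_continuousMap_lifts
    (A := ball (0:ℂ) r) ⟨(ball (0:ℂ) r).domRestrict φ,
      continuousOn_iff_continuous_domRestrict.mp hφ.continuousOn⟩ (a₀ := ⟨0, h0⟩)
      (e₀ := ⟨z0, by simpa [E] using hz0.le⟩) hPz0 (fun a => ⟨a, a.2, rfl⟩)
  let H : ℂ → ℂ := fun z => if hz : z ∈ ball (0:ℂ) r then (F ⟨z, hz⟩ : E) else 0
  have hH : ∀ z (hz : z ∈ ball (0:ℂ) r), H z = (F ⟨z, hz⟩ : E) := fun z hz => dif_pos hz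
  have hHF : ∀ z ∈ ball (0:ℂ) r, P.eval (H z) = φ z := by
    intro z hz
    rw [hH z hz]
    exact congrFun hF ⟨z, hz⟩
  have hHi : ∀ z ∈ ball (0:ℂ) r, ‖H z‖ < R ∧ P.derivative.eval (H z) ≠ 0 := by
    intro z hz
    have := hintr (F ⟨z, hz⟩) ⟨z, hz, (congrFun hF ⟨z, hz⟩).symm⟩
    rwa [← hH z hz] at this
  have hHc : ContinuousOn H (ball 0 r) := by
    rw [continuousOn_iff_continuous_domRestrict]
    have : (ball (0:ℂ) r).domRestrict H = Subtype.val ∘ F := by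
      ext ⟨z, hz⟩
      exact hH z hz
    rw [this]
    exact continuous_subtype_val.comp F.continuous
  refine ⟨H, ?_, fun z hz => ⟨(hHi z hz).1, hHF z hz⟩, ?_⟩
  · intro z hz
    have hn := isOpen_ball.mem_nhds hz
    have hd := P.hasStrictDerivAt (H z)
    have hd0 := (hHi z hz).2
    have hψ := (hd.to_localInverse hd0).hasDerivAt.differentiableAt
    have hev := hd.eventually_left_inverse hd0
    have hct : ContinuousAt H z := hHc.continuousAt hn
    have hev2 := hct.eventually hev
    rw [hHF z hz] at hψ
    have hcomp := hψ.comp z (hφ.differentiableAt hn)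
    refine (hcomp.congr_of_eventuallyEq ?_).differentiableWithinAt
    filter_upwards [hev2, hn] with y hy hyb
    rw [← hy]
    simp only [Function.comp]
    rw [hHF y hyb]
  · rw [hH 0 h0, hF0]

end KS

namespace KS
open Polynomial Metric Filter Topology

/-- The anti-holomorphic map `z ↦ conj (P z)`. -/
noncomputable def tau (P : ℂ[X]) (z : ℂ) : ℂ := (starRingEnd ℂ) (P.eval z)

theorem basin_back (P : ℂ[X]) (z0 z : ℂ)
    (h : Tendsto (fun k => (tau P)^[k] (tau P z)) atTop (𝓝 z0)) :
    Tendsto (fun k => (tau P)^[k] z) atTop (𝓝 z0) := by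
  rw [← tendsto_add_atTop_iff_nat 1]
  simpa only [Function.iterate_succ_apply] using h

theorem local_basin (P : ℂ[X]) (z0 : ℂ) (hfix : tau P z0 = z0)
    (hder : ‖P.derivative.eval z0‖ < 1) :
    ∃ r > 0, ∀ z ∈ ball z0 r, Tendsto (fun k => (tau P)^[k] z) atTop (𝓝 z0) := by
  set a := ‖P.derivative.eval z0‖ with ha
  have ha0 : 0 ≤ a := norm_nonneg _
  have hd := (P.hasDerivAt z0)
  have hlo := (hasDerivAt_iff_isLittleO.mp hd).def (c := (1 - a) / 2) (by linarith)
  obtain ⟨r, hr, hball⟩ := Metric.eventually_nhds_iff_ball.mp hlo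
  refine ⟨r, hr, ?_⟩
  have hstep : ∀ z ∈ ball z0 r, ‖tau P z - z0‖ ≤ (1 + a) / 2 * ‖z - z0‖ := by
    intro z hz
    have h1 := hball z hz
    have h2 : ‖tau P z - z0‖ = ‖P.eval z - P.eval z0‖ := by
      conv_lhs => rw [← hfix]
      unfold tau
      rw [← map_sub, Complex.norm_conj]
    rw [h2]
    have h3 : P.eval z - P.eval z0 = (P.eval z - P.eval z0 - (z - z0) • P.derivative.eval z0)
      + (z - z0) • P.derivative.eval z0 := by ring
    rw [h3]
    refine (norm_add_le _ _).trans ?_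
    rw [norm_smul, ← ha]
    linarith
  intro z hz
  have hz' : ‖z - z0‖ < r := by simpa [dist_eq_norm] using hz
  have hit : ∀ k, ‖(tau P)^[k] z - z0‖ ≤ ((1 + a) / 2) ^ k * ‖z - z0‖ := by
    intro k
    induction k with
    | zero => simp
    | succ k ih =>
      rw [Function.iterate_succ_apply']
      have hp1 : ((1 + a) / 2) ^ k ≤ 1 := pow_le_one₀ (by linarith) (by linarith)
      have hin : (tau P)^[k] z ∈ ball z0 r := by
        rw [mem_ball, dist_eq_norm]
        refine lt_of_le_of_lt ih (lt_of_le_of_lt ?_ hz')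
        exact mul_le_of_le_one_left (norm_nonneg _) hp1
      refine (hstep _ hin).trans ?_
      rw [pow_succ']
      calc _ ≤ (1 + a) / 2 * (((1 + a) / 2) ^ k * ‖z - z0‖) := by
            apply mul_le_mul_of_nonneg_left ih; linarith
        _ = _ := by ring
  rw [tendsto_iff_norm_sub_tendsto_zero]
  refine squeeze_zero (fun _ => norm_nonneg _) hit ?_
  have := (tendsto_pow_atTop_nhds_zero_of_lt_one (r := (1 + a) / 2) (by linarith) (by linarith)).mul_const (‖z - z0‖)
  simpa using this

theorem attract (P : ℂ[X]) (R : ℝ) (hR : ∀ z : ℂ, ‖z‖ = R → R < ‖P.eval z‖)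
    (z0 : ℂ) (hz0 : ‖z0‖ < R) (hfix : tau P z0 = z0) (hder : ‖P.derivative.eval z0‖ < 1) :
    ∃ c : ℂ, ‖c‖ < R ∧ P.derivative.eval c = 0 ∧
      Tendsto (fun k => (tau P)^[k] c) atTop (𝓝 z0) := by
  by_cases hcz : P.derivative.eval z0 = 0
  · refine ⟨z0, hz0, hcz, ?_⟩
    have : ∀ k, (tau P)^[k] z0 = z0 := fun k => Function.iterate_fixed hfix k
    simp [this]
  by_contra hno
  push Not at hno
  obtain ⟨r1, hr1, hb⟩ := local_basin P z0 hfix hder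
  set r := min r1 (R - ‖z0‖) with hrdef
  have hr : 0 < r := lt_min hr1 (by linarith)
  set a := ‖P.derivative.eval z0‖ with ha
  have hapos : 0 < a := norm_pos_iff.mpr hcz
  have h0 : (0:ℂ) ∈ ball (0:ℂ) r := by simpa using hr
  have key : ∀ k : ℕ, ∃ H : ℂ → ℂ, DifferentiableOn ℂ H (ball 0 r) ∧
      (∀ ζ ∈ ball (0:ℂ) r, ‖H ζ‖ < R ∧ Tendsto (fun k => (tau P)^[k] (H ζ)) atTop (𝓝 z0)) ∧
      H 0 = z0 ∧ ‖deriv H 0‖ = (a⁻¹) ^ k := by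
    intro k
    induction k with
    | zero =>
      refine ⟨fun ζ => z0 + ζ, by fun_prop, ?_, by simp, by simp⟩
      intro ζ hζ
      have h1 : ‖ζ‖ < r := by simpa using hζ
      refine ⟨?_, hb _ ?_⟩
      · have := norm_add_le z0 ζ
        have := min_le_right r1 (R - ‖z0‖)
        linarith
      · have := min_le_left r1 (R - ‖z0‖)
        simp only [mem_ball, dist_eq_norm, add_sub_cancel_left]
        linarith
    | succ k ih =>
      obtain ⟨H, hHd, hHR, hH0, hHder⟩ := ih
      let φ : ℂ → ℂ := fun ζ => (starRingEnd ℂ) (H ((starRingEnd ℂ) ζ))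
      have hconjball : ∀ ζ ∈ ball (0:ℂ) r, (starRingEnd ℂ) ζ ∈ ball (0:ℂ) r := by
        intro ζ hζ
        simpa using hζ
      have hφd : ∀ ζ ∈ ball (0:ℂ) r, HasDerivAt φ ((starRingEnd ℂ) (deriv H ((starRingEnd ℂ) ζ))) ζ := by
        intro ζ hζ
        have h1 := (hHd.differentiableAt (isOpen_ball.mem_nhds (hconjball ζ hζ))).hasDerivAt
        have h2 := h1.conj_conj
        simpa [φ, Function.comp_def] using h2
      obtain ⟨G, hGd, hG, hG0⟩ := lift_disc P R hR r hr φ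
        (fun ζ hζ => (hφd ζ hζ).differentiableAt.differentiableWithinAt)
        (fun ζ hζ => by
          simp only [φ, Complex.norm_conj]
          exact (hHR _ (hconjball ζ hζ)).1)
        (by
          intro c hc hc0 ζ hζ heq
          apply hno c hc hc0
          apply basin_back
          have : tau P c = H ((starRingEnd ℂ) ζ) := by
            unfold tau
            rw [← heq]
            simp [φ]
          rw [this]
          exact (hHR _ (hconjball ζ hζ)).2)
        z0 hz0 (by
          simp only [φ, map_zero, hH0]
          conv_rhs => rw [← hfix]
          simp [tau])
      refine ⟨G, hGd, ?_, hG0, ?_⟩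
      · intro ζ hζ
        refine ⟨(hG ζ hζ).1, basin_back P z0 _ ?_⟩
        have : tau P (G ζ) = H ((starRingEnd ℂ) ζ) := by
          unfold tau
          rw [(hG ζ hζ).2]
          simp [φ]
        rw [this]
        exact (hHR _ (hconjball ζ hζ)).2
      · have h1 := (hGd.differentiableAt (isOpen_ball.mem_nhds h0)).hasDerivAt
        have h2 : HasDerivAt (fun z => P.eval z) (P.derivative.eval z0) (G 0) := by
          rw [hG0]; exact P.hasDerivAt z0
        have h3 := h2.comp 0 h1
        have h4 := hφd 0 h0
        have h5 : φ =ᶠ[𝓝 0] ((fun z => P.eval z) ∘ G) := by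
          filter_upwards [isOpen_ball.mem_nhds h0] with ζ hζ
          exact (hG ζ hζ).2.symm
        have h6 := (h3.congr_of_eventuallyEq h5).unique h4
        have h7 := congrArg norm h6
        rw [norm_mul, Complex.norm_conj, map_zero, hHder, ← ha] at h7
        rw [pow_succ, ← h7]
        field_simp
  have hinv : 1 < a⁻¹ := (one_lt_inv₀ hapos).mpr hder
  obtain ⟨k, hk⟩ := pow_unbounded_of_one_lt (2 * R / r) hinv
  obtain ⟨H, hHd, hHR, hH0, hHder⟩ := key k
  have := Complex.norm_deriv_le_div_of_mapsTo_ball (R₂ := 2 * R) hHd (fun ζ hζ => by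
    rw [mem_closedBall, dist_eq_norm]
    have h1 := (hHR ζ hζ).1
    have h2 := (hHR 0 h0).1
    have := norm_sub_le (H ζ) (H 0)
    linarith) hr
  rw [hHder] at this
  linarith

end KS

namespace KS
open Polynomial Metric Filter Topology

theorem growth (p : ℂ[X]) (hp : 1 < p.natDegree) :
    ∃ R0 : ℝ, ∀ z : ℂ, R0 ≤ ‖z‖ → ‖z‖ + 1 < ‖p.eval z‖ := by
  have hdeg : 0 < p.divX.degree := by
    rw [← natDegree_pos_iff_degree_pos, natDegree_divX_eq_natDegree_tsub_one]
    omega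
  have ht := p.divX.tendsto_norm_atTop (l := comap (norm : ℂ → ℝ) atTop) hdeg (z := id) tendsto_comap
  have hev := ht.eventually_ge_atTop 2
  obtain ⟨R0, -, hR0⟩ := (atTop_basis.comap (norm : ℂ → ℝ)).eventually_iff.mp hev
  refine ⟨max R0 (‖p.coeff 0‖ + 2), fun z hz => ?_⟩
  have h1 : 2 ≤ ‖p.divX.eval z‖ := hR0 (show ‖z‖ ∈ Set.Ici R0 from (le_max_left _ _).trans hz)
  have h2 : ‖p.coeff 0‖ + 2 ≤ ‖z‖ := (le_max_right _ _).trans hz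
  have h3 : p.eval z = p.divX.eval z * z + p.coeff 0 := by
    conv_lhs => rw [← divX_mul_X_add p]
    simp
  rw [h3]
  have h4 := norm_sub_le_norm_add (p.divX.eval z * z) (p.coeff 0)
  rw [norm_mul] at h4
  nlinarith [norm_nonneg z, norm_nonneg (p.coeff 0)]

theorem card_nonrepelling (p : ℂ[X]) (hp : 1 < p.natDegree) (T : Finset ℂ)
    (hT : ∀ z ∈ T, tau p z = z ∧ ‖p.derivative.eval z‖ ≤ 1) : T.card ≤ p.natDegree - 1 := by
  classical
  obtain ⟨R0, hR0⟩ := growth p hp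
  set w : ℂ[X] := Lagrange.nodal T id with hw
  have hwz : ∀ z ∈ T, w.eval z = 0 := fun z hz => Lagrange.eval_nodal_at_node (v := id) hz
  have hw'z : ∀ z ∈ T, w.derivative.eval z ≠ 0 := by
    intro z hz
    have := Lagrange.eval_nodal_derivative_eval_node_eq (v := (id : ℂ → ℂ)) hz
    simp only [id] at this
    rw [hw, this, Lagrange.eval_nodal, Finset.prod_ne_zero_iff]
    intro y hy
    simp only [id]
    exact sub_ne_zero.mpr (Finset.ne_of_mem_erase hy).symm
  set u : ℂ[X] := Lagrange.interpolate T id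
    (fun z => -(p.derivative.eval z * w.derivative.eval z)⁻¹) with hu
  have huz : ∀ z ∈ T, u.eval z = -(p.derivative.eval z * w.derivative.eval z)⁻¹ := fun z hz =>
    Lagrange.eval_interpolate_at_node (v := id) _ (Set.injOn_id _) hz
  set rr : ℂ[X] := w * u with hrr
  set q : ℂ[X] := p.derivative ^ 2 * rr with hq
  set s : ℂ[X] := 2 * p.derivative.derivative * rr + p.derivative * rr.derivative with hs
  have hqz : ∀ z ∈ T, q.eval z = 0 := by
    intro z hz
    simp [hq, hrr, hwz z hz]
  have hq' : q.derivative = p.derivative * s := by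
    rw [hq, hs, pow_two, derivative_mul, derivative_mul]
    ring
  have hsz : ∀ z ∈ T, p.derivative.eval z ≠ 0 → s.eval z = -1 := by
    intro z hz hne
    have := hw'z z hz
    simp only [hs, hrr, eval_add, eval_mul, hwz z hz, derivative_mul, huz z hz]
    field_simp
    ring
  set R : ℝ := max R0 0 + 1 + ∑ z ∈ T, ‖z‖ with hRdef
  have hsum : 0 ≤ ∑ z ∈ T, ‖z‖ := Finset.sum_nonneg fun _ _ => norm_nonneg _
  have hRR0 : R0 ≤ R := by
    have := le_max_left R0 0
    linarith
  have hzR : ∀ z ∈ T, ‖z‖ < R := by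
    intro z hz
    have h1 : ‖z‖ ≤ ∑ z ∈ T, ‖z‖ := Finset.single_le_sum (f := fun z : ℂ => ‖z‖) (fun _ _ => norm_nonneg _) hz
    have := le_max_right R0 0
    linarith
  obtain ⟨M1, hM1⟩ := (isCompact_closedBall (0:ℂ) R).exists_bound_of_continuousOn q.continuous.continuousOn
  obtain ⟨M2, hM2⟩ := (isCompact_closedBall (0:ℂ) R).exists_bound_of_continuousOn s.continuous.continuousOn
  set M : ℝ := max 0 (max M1 M2) with hM
  have hM0 : 0 ≤ M := le_max_left _ _
  have hq1 : ∀ z : ℂ, ‖z‖ ≤ R → ‖q.eval z‖ ≤ M := fun z hz =>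
    (hM1 z (by simpa using hz)).trans ((le_max_left _ _).trans (le_max_right _ _))
  have hs1 : ∀ z : ℂ, ‖z‖ ≤ R → ‖s.eval z‖ ≤ M := fun z hz =>
    (hM2 z (by simpa using hz)).trans ((le_max_right _ _).trans (le_max_right _ _))
  set t : ℝ := 1 / (M + 2) with ht
  have ht0 : 0 < t := by positivity
  have htM : t * M < 1 := by
    rw [ht, div_mul_eq_mul_div, one_mul, div_lt_one (by linarith)]; linarith
  have ht1 : t < 1 := by
    rw [ht, div_lt_one (by linarith)]; linarith
  set P : ℂ[X] := p + C (t:ℂ) * q with hP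
  have hP' : P.derivative = p.derivative * (1 + C (t:ℂ) * s) := by
    rw [hP, derivative_add, derivative_C_mul, hq']
    ring
  have hnt : ‖(t:ℂ)‖ = t := by simp [abs_of_pos ht0]
  have hPR : ∀ z : ℂ, ‖z‖ = R → R < ‖P.eval z‖ := by
    intro z hz
    have h1 := hR0 z (hz ▸ hRR0)
    have h2 := hq1 z hz.le
    have h3 : P.eval z = p.eval z + t * q.eval z := by simp [hP]
    rw [h3]
    have h4 := norm_sub_le_norm_add (p.eval z) (t * q.eval z)
    rw [norm_mul, hnt] at h4
    have h5 : t * ‖q.eval z‖ ≤ t * M := mul_le_mul_of_nonneg_left h2 ht0.le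
    linarith
  have hc : ∀ z ∈ T, ∃ c : ℂ, p.derivative.eval c = 0 ∧
      Tendsto (fun k => (tau P)^[k] c) atTop (𝓝 z) := by
    intro z hz
    obtain ⟨hfix, hd⟩ := hT z hz
    have hfixP : tau P z = z := by
      rw [← hfix]
      simp only [hfix]
      simp only [tau, hP, eval_add, eval_mul, hqz z hz, mul_zero, add_zero]
      exact hfix
    have hdP : ‖P.derivative.eval z‖ < 1 := by
      by_cases h0 : p.derivative.eval z = 0
      · simp [hP', h0]
      · rw [hP', eval_mul, norm_mul]
        have : eval z (1 + C (t:ℂ) * s) = ((1 - t : ℝ) : ℂ) := by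
          simp [hsz z hz h0, sub_eq_add_neg]
        rw [this, Complex.norm_real, Real.norm_of_nonneg (by linarith)]
        nlinarith [norm_nonneg (p.derivative.eval z)]
    obtain ⟨c, hcR, hc0, hct⟩ := attract P R hPR z (hzR z hz) hfixP hdP
    refine ⟨c, ?_, hct⟩
    rw [hP', eval_mul, mul_eq_zero] at hc0
    rcases hc0 with h | h
    · exact h
    · exfalso
      simp only [eval_add, eval_one, eval_mul, eval_C] at h
      have h1 : (t:ℂ) * s.eval c = -1 := by linear_combination h
      have h2 := congrArg norm h1
      rw [norm_mul, hnt, norm_neg, norm_one] at h2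
      have h5 : t * ‖s.eval c‖ ≤ t * M := mul_le_mul_of_nonneg_left (hs1 c hcR.le) ht0.le
      linarith
  choose! c hc0 hct using hc
  have hp'0 : p.derivative ≠ 0 := by
    intro h
    have := derivative_eq_zero.mp h
    omega
  calc T.card ≤ p.derivative.roots.toFinset.card := by
        apply Finset.card_le_card_of_injOn c
        · intro z hz
          simp only [SetLike.mem_coe, Multiset.mem_toFinset, mem_roots hp'0, IsRoot.def]
          exact hc0 z hz
        · intro z hz y hy hzy
          have h1 := hct z hz
          have h2 := hct y hy
          rw [hzy] at h1
          exact tendsto_nhds_unique h1 h2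
    _ ≤ p.derivative.roots.card := Multiset.toFinset_card_le _
    _ ≤ p.derivative.natDegree := card_roots' _
    _ ≤ p.natDegree - 1 := natDegree_derivative_le p

end KS

namespace KS
open Polynomial

/-- The anti-linear substitution `g ↦ (conj g)(p)`. -/
noncomputable def sig (p g : ℂ[X]) : ℂ[X] := (g.map (starRingEnd ℂ)).comp p

/-- The polynomial whose roots are the fixed points of the second iterate of `tau p`. -/
noncomputable def RR (p : ℂ[X]) : ℂ[X] := sig p p - X

theorem sig_add (p g h : ℂ[X]) : sig p (g + h) = sig p g + sig p h := by simp [sig]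
theorem sig_sub (p g h : ℂ[X]) : sig p (g - h) = sig p g - sig p h := by simp [sig]
theorem sig_mul (p g h : ℂ[X]) : sig p (g * h) = sig p g * sig p h := by simp [sig]
theorem sig_pow (p g : ℂ[X]) (k : ℕ) : sig p (g ^ k) = sig p g ^ k := by simp [sig]
theorem sig_X (p : ℂ[X]) : sig p X = p := by simp [sig]
theorem sig_C (p : ℂ[X]) (a : ℂ) : sig p (C a) = C ((starRingEnd ℂ) a) := by simp [sig]
theorem sig_self (p : ℂ[X]) : sig p p = RR p + X := by simp [RR]

theorem eval_sig (p g : ℂ[X]) (z : ℂ) :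
    (sig p g).eval z = (starRingEnd ℂ) (g.eval (tau p z)) := by
  unfold sig tau
  rw [eval_comp, eval_map]
  conv_lhs => rw [← Complex.conj_conj (p.eval z)]
  exact eval₂_at_apply (starRingEnd ℂ) _

theorem isRoot_RR (p : ℂ[X]) (z : ℂ) : (RR p).eval z = 0 ↔ tau p (tau p z) = z := by
  rw [RR, eval_sub, eval_sig, eval_X, sub_eq_zero]
  rfl

theorem natDegree_RR (p : ℂ[X]) (hp : 1 < p.natDegree) :
    (RR p).natDegree = p.natDegree * p.natDegree := by
  have h : (sig p p).natDegree = p.natDegree * p.natDegree := by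
    rw [sig, natDegree_comp, natDegree_map]
  rw [RR, natDegree_sub_eq_left_of_natDegree_lt, h]
  rw [h, natDegree_X]
  nlinarith

theorem eval_deriv_RR (p : ℂ[X]) (z : ℂ) : (RR p).derivative.eval z =
    (starRingEnd ℂ) (p.derivative.eval (tau p z)) * p.derivative.eval z - 1 := by
  have := eval_sig p p.derivative z
  rw [← this, RR, derivative_sub, sig, derivative_comp, derivative_map, sig]
  simp
  ring

theorem eval_deriv_RR_fix (p : ℂ[X]) (z : ℂ) (hz : tau p z = z) : (RR p).derivative.eval z =
    ((‖p.derivative.eval z‖ ^ 2 - 1 : ℝ) : ℂ) := by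
  rw [eval_deriv_RR, hz, Complex.conj_mul']
  push_cast
  rfl

theorem RR_dvd_sig (p : ℂ[X]) : RR p ∣ sig p (RR p) := by
  have h1 : sig p (RR p) = (p.map C).eval (sig p p) - (p.map C).eval X := by
    rw [RR, sig_sub, sig_X]
    congr 1
    · rw [eval_map, ← comp, sig, sig]
      rw [map_comp, map_map]
      have : (starRingEnd ℂ).comp (starRingEnd ℂ) = RingHom.id ℂ := by
        ext x; simp
      rw [this, map_id, comp_assoc]
    · rw [eval_map, ← comp, comp_X]
  rw [h1, RR]
  exact sub_dvd_eval_sub _ _ _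

theorem sig_dvd (p k : ℂ[X]) (z : ℂ) (e : ℕ) (h : (X - C (tau p z)) ^ e ∣ k) :
    (X - C z) ^ e ∣ sig p k := by
  obtain ⟨q, rfl⟩ := h
  rw [sig_mul, sig_pow, sig_sub, sig_X, sig_C]
  refine Dvd.dvd.mul_right (pow_dvd_pow_of_dvd ?_ e) _
  rw [dvd_iff_isRoot]
  simp [tau]

theorem mult_le (p : ℂ[X]) (hp : 1 < p.natDegree) (z : ℂ) (hz : (RR p).eval z = 0) :
    (RR p).rootMultiplicity z ≤ (RR p).rootMultiplicity (tau p z) := by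
  have hR0 : RR p ≠ 0 := by
    intro h
    have := natDegree_RR p hp
    rw [h, natDegree_zero] at this
    nlinarith
  have hrt : (RR p).eval (tau p z) = 0 := by
    rw [isRoot_RR] at hz ⊢
    rw [hz]
  by_cases hm : (RR p).rootMultiplicity z ≤ 1
  · exact hm.trans ((rootMultiplicity_pos hR0).mpr hrt)
  push Not at hm
  have hd := (one_lt_rootMultiplicity_iff_isRoot hR0).mp hm
  have hp' : p.derivative.eval z ≠ 0 := by
    intro h
    have h2 := hd.2
    rw [IsRoot.def, eval_deriv_RR, h] at h2
    simp at h2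
  obtain ⟨Q, hQ, hQn⟩ := exists_eq_pow_rootMultiplicity_mul_and_not_dvd (RR p) hR0 (tau p z)
  set m := (RR p).rootMultiplicity z
  set m' := (RR p).rootMultiplicity (tau p z)
  have h1 : (X - C z) ^ m ∣ sig p (RR p) := (pow_rootMultiplicity_dvd _ _).trans (RR_dvd_sig p)
  obtain ⟨p1, hp1⟩ := dvd_iff_isRoot.mpr (show (p - C (p.eval z)).IsRoot z by simp)
  have hp1z : p1.eval z = p.derivative.eval z := by
    have := congrArg (fun f => (derivative f).eval z) hp1
    simpa using this.symm
  have h2 : sig p (RR p) = (X - C z) ^ m' * (p1 ^ m' * sig p Q) := by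
    rw [hQ, sig_mul, sig_pow, sig_sub, sig_X, sig_C]
    have : (starRingEnd ℂ) (tau p z) = p.eval z := by simp [tau]
    rw [this, hp1, mul_pow]
    ring
  rw [h2] at h1
  have h3 : ¬ (X - C z) ∣ p1 ^ m' * sig p Q := by
    rw [dvd_iff_isRoot, IsRoot.def, eval_mul, eval_pow, hp1z, eval_sig]
    rw [dvd_iff_isRoot, IsRoot.def] at hQn
    exact mul_ne_zero (pow_ne_zero _ hp') (by simpa using hQn)
  have h4 := (prime_X_sub_C z).pow_dvd_of_dvd_mul_right m h3 h1
  exact (pow_dvd_pow_iff (X_sub_C_ne_zero z) (not_isUnit_X_sub_C z)).mp h4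

theorem dvd_of_mult (R G : ℂ[X]) (hR : R ≠ 0)
    (h : ∀ z, R.eval z = 0 → (X - C z) ^ (R.rootMultiplicity z) ∣ G) : R ∣ G := by
  classical
  by_cases hG : G = 0
  · simp [hG]
  refine (IsAlgClosed.splits R).dvd_of_roots_le_roots hR ?_
  rw [Multiset.le_iff_count]
  intro z
  rw [count_roots, count_roots, le_rootMultiplicity_iff hG]
  by_cases hz : R.eval z = 0
  · exact h z hz
  · rw [rootMultiplicity_eq_zero hz]; simp

/-- residue functional. -/
theorem exists_lam (R : ℂ[X]) (hR : R ≠ 0) : ∃ lam : ℂ[X] →ₗ[ℂ] ℂ,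
    (∀ g : ℂ[X], g.degree < R.degree → lam g = g.coeff (R.natDegree - 1)) ∧
    ∀ g, R ∣ g → lam g = 0 := by
  have hmon := monic_mul_leadingCoeff_inv hR
  set R' := R * C R.leadingCoeff⁻¹ with hR'
  refine ⟨(lcoeff ℂ (R.natDegree - 1)).comp (modByMonicHom R'), ?_, ?_⟩
  · intro g hg
    simp only [LinearMap.comp_apply, lcoeff_apply, modByMonicHom_apply]
    rw [(modByMonic_eq_self_iff hmon).mpr]
    rwa [hR', degree_mul_leadingCoeff_inv _ hR]
  · intro g hg
    have : R' ∣ g := by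
      refine dvd_trans ?_ hg
      refine ⟨C R.leadingCoeff, ?_⟩
      rw [hR', mul_assoc, ← C_mul, inv_mul_cancel₀ (leadingCoeff_ne_zero.mpr hR)]
      simp
    simp only [LinearMap.comp_apply, lcoeff_apply, modByMonicHom_apply]
    rw [(modByMonic_eq_zero_iff_dvd hmon).mpr this]
    simp

theorem residue_sum (R : ℂ[X]) (hR : R ≠ 0) (lam : ℂ[X] →ₗ[ℂ] ℂ)
    (h1 : ∀ g : ℂ[X], g.degree < R.degree → lam g = g.coeff (R.natDegree - 1))
    (h2 : ∀ g, R ∣ g → lam g = 0) (S : Finset ℂ)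
    (hS : ∀ z ∈ S, R.eval z = 0 ∧ R.derivative.eval z ≠ 0) (G : ℂ[X])
    (hG : ∀ z, R.eval z = 0 → z ∉ S → (X - C z) ^ (R.rootMultiplicity z) ∣ G)
    (hlam : lam G = 0) : ∑ z ∈ S, G.eval z / R.derivative.eval z = 0 := by
  classical
  have hQ : ∀ z ∈ S, R = (X - C z) * (R /ₘ (X - C z)) := fun z hz =>
    (mul_divByMonic_eq_iff_isRoot.mpr (hS z hz).1).symm
  set Q : ℂ → ℂ[X] := fun z => R /ₘ (X - C z) with hQdef
  have hQ' : ∀ z ∈ S, (Q z).eval z = R.derivative.eval z := by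
    intro z hz
    have := congrArg (fun f => (derivative f).eval z) (hQ z hz)
    simpa using this.symm
  have hQ0 : ∀ w ∈ S, ∀ z, R.eval z = 0 → z ≠ w → (X - C z) ^ (R.rootMultiplicity z) ∣ Q w := by
    intro w hw z hz hne
    have hd : (X - C z) ^ (R.rootMultiplicity z) ∣ (X - C w) * Q w := by
      have := pow_rootMultiplicity_dvd R z
      rwa [hQ w hw] at this ⊢
      
    have hco : IsCoprime ((X - C z) ^ (R.rootMultiplicity z)) (X - C w) :=
      (pairwise_coprime_X_sub_C Function.injective_id hne).pow_left
    exact hco.dvd_of_dvd_mul_left hd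
  have hlamQ : ∀ z ∈ S, lam (Q z) = R.leadingCoeff := by
    intro z hz
    have hQne : Q z ≠ 0 := by
      intro h
      have := hQ z hz
      rw [show R /ₘ (X - C z) = Q z from rfl, h, mul_zero] at this
      exact hR this
    have hnd : R.natDegree = 1 + (Q z).natDegree := by
      conv_lhs => rw [hQ z hz]
      rw [natDegree_mul (X_sub_C_ne_zero z) hQne, natDegree_X_sub_C]
    rw [h1, hnd, Nat.add_sub_cancel_left]
    · conv_rhs => rw [hQ z hz]
      rw [leadingCoeff_mul, leadingCoeff_X_sub_C, one_mul]
      rfl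
    · rw [degree_eq_natDegree hQne, degree_eq_natDegree hR, hnd]
      exact_mod_cast (by omega)
  have hdvd : R ∣ G - ∑ z ∈ S, C (G.eval z / R.derivative.eval z) * Q z := by
    apply dvd_of_mult R _ hR
    intro z hz
    by_cases hzS : z ∈ S
    · have hm : R.rootMultiplicity z ≤ 1 := by
        by_contra hcon
        push Not at hcon
        exact (hS z hzS).2 ((one_lt_rootMultiplicity_iff_isRoot hR).mp hcon).2
      refine (pow_dvd_pow _ hm).trans ?_
      rw [pow_one, dvd_iff_isRoot, IsRoot.def, eval_sub, eval_finsetSum, Finset.sum_eq_single z]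
      · rw [eval_mul, eval_C, hQ' z hzS, div_mul_cancel₀ _ (hS z hzS).2, sub_self]
      · intro w hw hne
        have h3 := hQ0 w hw z hz hne.symm
        have h4 : (X - C z) ∣ Q w := by
          refine dvd_trans ?_ h3
          exact dvd_pow_self _ ((rootMultiplicity_pos hR).mpr hz).ne'
        rw [dvd_iff_isRoot, IsRoot.def] at h4
        simp [h4]
      · intro h; exact absurd hzS h
    · refine dvd_sub (hG z hz hzS) (Finset.dvd_sum fun w hw => ?_)
      refine Dvd.dvd.mul_left (hQ0 w hw z hz ?_) _
      rintro rfl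
      exact hzS hw
  have h3 := h2 _ hdvd
  rw [map_sub, hlam, zero_sub, neg_eq_zero, map_sum] at h3
  have h4 : ∑ z ∈ S, (G.eval z / R.derivative.eval z) * R.leadingCoeff = 0 := by
    rw [← h3]
    refine Finset.sum_congr rfl fun z hz => ?_
    rw [← smul_eq_C_mul, map_smul, hlamQ z hz, smul_eq_mul]
  rw [← Finset.sum_mul, mul_eq_zero] at h4
  exact h4.resolve_right (leadingCoeff_ne_zero.mpr hR)

end KS

namespace KS
open Polynomial

theorem lam_step (lam : ℂ[X] →ₗ[ℂ] ℂ) (n : ℕ) (a : ℂ) (ha : a ≠ 0) (A B : ℂ[X]) (b : ℕ → ℂ)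
    (D : ℕ → ℂ[X]) (h : C a * A = B - ∑ i ∈ Finset.range n, C (b i) * D i) (hB : lam B = 0)
    (hD : ∀ i < n, lam (D i) = 0) : lam A = 0 := by
  have h1 := congrArg lam h
  rw [map_sub, hB, map_sum, ← smul_eq_C_mul, map_smul, Finset.sum_eq_zero] at h1
  · simpa [ha] using h1
  · intro i hi
    rw [← smul_eq_C_mul, map_smul, hD i (Finset.mem_range.mp hi), smul_zero]

theorem sum_id (a : ℂ) (Y E Q : ℂ[X]) (n k : ℕ) (b : ℕ → ℂ)
    (h : C a * Y ^ n = Q - ∑ i ∈ Finset.range n, C (b i) * Y ^ i) :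
    C a * (E * Y ^ (k + n)) = E * Y ^ k * Q
      - ∑ i ∈ Finset.range n, C (b i) * (E * Y ^ (k + i)) := by
  have h1 : C a * (E * Y ^ (k + n)) = E * Y ^ k * (C a * Y ^ n) := by
    rw [pow_add]; ring
  rw [h1, h, mul_sub, Finset.mul_sum]
  congr 1
  refine Finset.sum_congr rfl fun i _ => ?_
  rw [pow_add]; ring

theorem lam_mono (p : ℂ[X]) (hp : 1 < p.natDegree) (lam : ℂ[X] →ₗ[ℂ] ℂ)
    (h1 : ∀ g : ℂ[X], g.degree < (RR p).degree → lam g = g.coeff ((RR p).natDegree - 1))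
    (h2 : ∀ g, RR p ∣ g → lam g = 0) :
    ∀ m : ℕ, m + 2 < 2 * p.natDegree → ∀ c d : ℕ, c + d = m → lam (X ^ c * p ^ d) = 0 := by
  have hp0 : p ≠ 0 := by rintro rfl; simp at hp
  have hN := natDegree_RR p hp
  set n := p.natDegree with hn
  have hR0 : RR p ≠ 0 := by
    intro h
    rw [h, natDegree_zero] at hN
    nlinarith
  have hlead : p.coeff n ≠ 0 := by
    rw [hn, coeff_natDegree]; exact leadingCoeff_ne_zero.mpr hp0
  intro m
  induction m using Nat.strong_induction_on with
  | _ m ih =>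
    intro hm c d hcd
    by_cases hc : n ≤ c
    · have hpe : C (p.coeff n) * X ^ n = p - ∑ i ∈ Finset.range n, C (p.coeff i) * X ^ i := by
        have := p.as_sum_range_C_mul_X_pow
        rw [← hn, Finset.sum_range_succ] at this
        rw [eq_sub_iff_add_eq, add_comm]
        exact this.symm
      have hid := sum_id (p.coeff n) X (p ^ d) p n (c - n) (fun i => p.coeff i) hpe
      rw [Nat.sub_add_cancel hc] at hid
      rw [mul_comm]
      refine lam_step lam n (p.coeff n) hlead (p ^ d * X ^ c) (p ^ d * X ^ (c - n) * p)
        (fun i => p.coeff i) (fun i => p ^ d * X ^ (c - n + i)) hid ?_ ?_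
      · have h3 : p ^ d * X ^ (c - n) * p = X ^ (c - n) * p ^ (d + 1) := by
          rw [pow_succ]; ring
        rw [h3]
        exact ih (m - n + 1) (by omega) (by omega) _ _ (by omega)
      · intro i hi
        rw [mul_comm]
        exact ih (c - n + i + d) (by omega) (by omega) _ _ rfl
    by_cases hd : n ≤ d
    · have hpe : C ((starRingEnd ℂ) (p.coeff n)) * p ^ n = (RR p + X)
          - ∑ i ∈ Finset.range n, C ((starRingEnd ℂ) (p.coeff i)) * p ^ i := by
        have h3 : RR p + X = ∑ i ∈ Finset.range (n + 1), C ((starRingEnd ℂ) (p.coeff i)) * p ^ i := by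
          rw [← sig_self, sig, comp, eval₂_eq_sum_range, natDegree_map]
          simp [hn]
        rw [Finset.sum_range_succ] at h3
        rw [eq_sub_iff_add_eq, add_comm]
        exact h3.symm
      have hid := sum_id ((starRingEnd ℂ) (p.coeff n)) p (X ^ c) (RR p + X) n (d - n)
        (fun i => (starRingEnd ℂ) (p.coeff i)) hpe
      rw [Nat.sub_add_cancel hd] at hid
      refine lam_step lam n ((starRingEnd ℂ) (p.coeff n)) (by simpa using hlead) (X ^ c * p ^ d)
        (X ^ c * p ^ (d - n) * (RR p + X))
        (fun i => (starRingEnd ℂ) (p.coeff i)) (fun i => X ^ c * p ^ (d - n + i)) hid ?_ ?_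
      · have h3 : X ^ c * p ^ (d - n) * (RR p + X)
            = X ^ c * p ^ (d - n) * RR p + X ^ (c + 1) * p ^ (d - n) := by
          rw [pow_succ]; ring
        rw [h3, map_add, h2 _ (Dvd.intro_left _ rfl), zero_add]
        exact ih (m - n + 1) (by omega) (by omega) _ _ (by omega)
      · intro i hi
        exact ih (c + (d - n + i)) (by omega) (by omega) _ _ rfl
    · have hnd : (X ^ c * p ^ d).natDegree < (RR p).natDegree - 1 := by
        rw [hN, natDegree_mul (pow_ne_zero _ X_ne_zero) (pow_ne_zero _ hp0), natDegree_X_pow,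
          natDegree_pow, ← hn]
        have h5 : c + d * n + 2 ≤ n * n := by
          push Not at hc hd
          clear_value n
          obtain ⟨n', rfl⟩ : ∃ n', n = n' + 1 := ⟨n - 1, by omega⟩
          rcases Nat.lt_or_ge d n' with h | h
          · nlinarith
          · have : d = n' := by omega
            subst this
            nlinarith
        omega
      rw [h1]
      · exact coeff_eq_zero_of_natDegree_lt hnd
      · apply degree_lt_degree
        omega

/-- basis with degrees `0,1,2,…` -/
noncomputable def seqp (p : ℂ[X]) (hp : 1 < p.natDegree) : Polynomial.Sequence ℂ where
  elems' i := X ^ (i % p.natDegree) * p ^ (i / p.natDegree)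
  degree_eq' i := by
    have hp0 : p ≠ 0 := by rintro rfl; simp at hp
    rw [degree_mul, degree_X_pow, degree_pow, degree_eq_natDegree hp0]
    rw [nsmul_eq_mul]
    norm_cast
    rw [mul_comm]
    exact Nat.mod_add_div i p.natDegree

/-- index set of the isotropic subspace -/
def idx (n : ℕ) : Finset ℕ := (Finset.range (n * n)).filter fun i => i % n + i / n + 1 < n

/-- isotropic subspace -/
noncomputable def WW (p : ℂ[X]) : Submodule ℂ ℂ[X] :=
  Submodule.span ℂ ((fun i : ℕ => X ^ (i % p.natDegree) * p ^ (i / p.natDegree)) ''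
    (idx p.natDegree : Set ℕ))

theorem card_idx (n : ℕ) (hn : 1 < n) : n * n ≤ 2 * (idx n).card + n := by
  have h : (idx n).card = ((Finset.range n).sigma (fun b => Finset.range (n - 1 - b))).card := by
    symm
    apply Finset.card_bij (fun x _ => x.2 + n * x.1)
    · rintro ⟨b, a⟩ hx
      simp only [Finset.mem_sigma, Finset.mem_range] at hx
      have ha : a < n := by omega
      simp only [idx, Finset.mem_filter, Finset.mem_range]
      rw [Nat.add_mul_mod_self_left, Nat.mod_eq_of_lt ha, Nat.add_mul_div_left _ _ (by omega),
        Nat.div_eq_of_lt ha]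
      refine ⟨?_, by omega⟩
      nlinarith
    · rintro ⟨b, a⟩ hx ⟨b', a'⟩ hx' heq
      simp only [Finset.mem_sigma, Finset.mem_range] at hx hx' heq
      have ha : a < n := by omega
      have ha' : a' < n := by omega
      have h1 := congrArg (· % n) heq
      have h2 := congrArg (· / n) heq
      simp only [Nat.add_mul_mod_self_left, Nat.mod_eq_of_lt ha, Nat.mod_eq_of_lt ha'] at h1
      simp only [Nat.add_mul_div_left _ _ (show 0 < n by omega), Nat.div_eq_of_lt ha,
        Nat.div_eq_of_lt ha'] at h2
      obtain rfl : a = a' := h1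
      obtain rfl : b = b' := by omega
      rfl
    · intro i hi
      simp only [idx, Finset.mem_filter, Finset.mem_range] at hi
      refine ⟨⟨i / n, i % n⟩, ?_, Nat.mod_add_div i n⟩
      simp only [Finset.mem_sigma, Finset.mem_range]
      omega
  rw [h, Finset.card_sigma]
  simp only [Finset.card_range]
  obtain ⟨k, rfl⟩ : ∃ k, n = k + 1 := ⟨n - 1, by omega⟩
  have h2 : ∑ b ∈ Finset.range (k + 1), (k + 1 - 1 - b) = ∑ b ∈ Finset.range (k + 1), b := by
    rw [← Finset.sum_range_reflect]
    refine Finset.sum_congr rfl fun b hb => ?_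
    rw [Finset.mem_range] at hb
    omega
  rw [h2]
  have := Finset.sum_range_id_mul_two (k + 1)
  simp only [Nat.add_sub_cancel] at this
  nlinarith

theorem finrank_WW (p : ℂ[X]) (hp : 1 < p.natDegree) :
    Module.finrank ℂ (WW p) = (idx p.natDegree).card := by
  have hli := (seqp p hp).linearIndependent
  have hli2 := hli.comp (Subtype.val : idx p.natDegree → ℕ) Subtype.val_injective
  have := finrank_span_eq_card hli2
  rw [Fintype.card_coe] at this
  rw [← this]
  have h : Set.range (Subtype.val : idx p.natDegree → ℕ) = (idx p.natDegree : Set ℕ) := by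
    ext x; simp
  have hW : WW p = Submodule.span ℂ
      (Set.range ((seqp p hp) ∘ (Subtype.val : idx p.natDegree → ℕ))) := by
    rw [Set.range_comp, h]
    rfl
  rw [hW]

theorem WW_le (p : ℂ[X]) (hp : 1 < p.natDegree) :
    WW p ≤ degreeLT ℂ (p.natDegree * p.natDegree) := by
  unfold WW
  rw [Submodule.span_le]
  rintro _ ⟨i, hi, rfl⟩
  have hi' := (Finset.mem_filter.mp hi).1
  rw [SetLike.mem_coe, mem_degreeLT]
  have := (seqp p hp).degree_eq i
  refine lt_of_eq_of_lt this ?_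
  exact_mod_cast Finset.mem_range.mp hi'

theorem lam_WW (p : ℂ[X]) (hp : 1 < p.natDegree) (lam : ℂ[X] →ₗ[ℂ] ℂ)
    (h1 : ∀ g : ℂ[X], g.degree < (RR p).degree → lam g = g.coeff ((RR p).natDegree - 1))
    (h2 : ∀ g, RR p ∣ g → lam g = 0) (k : ℂ[X]) (hk : k ∈ WW p) (u : ℂ[X]) (hu : u ∈ WW p) :
    lam (k * u) = 0 ∧ lam (k * sig p u) = 0 := by
  have hm := lam_mono p hp lam h1 h2
  induction hk using Submodule.span_induction with
  | zero => simp
  | add x y _ _ hx hy => simp [add_mul, hx, hy]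
  | smul a x _ hx => simp [hx]
  | mem x hx =>
    obtain ⟨i, hi, rfl⟩ := hx
    have hi' := (Finset.mem_filter.mp hi).2
    induction hu using Submodule.span_induction with
    | zero => simp [sig]
    | add x y _ _ hx hy => simp [mul_add, sig_add, hx, hy]
    | smul a x _ hx =>
      refine ⟨by simp [hx], ?_⟩
      rw [smul_eq_C_mul, sig_mul, sig_C, mul_left_comm, ← smul_eq_C_mul, map_smul, hx.2, smul_zero]
    | mem y hy =>
      obtain ⟨j, hj, rfl⟩ := hy
      have hj' := (Finset.mem_filter.mp hj).2
      simp only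
      set n := p.natDegree
      constructor
      · have : X ^ (i % n) * p ^ (i / n) * (X ^ (j % n) * p ^ (j / n))
          = X ^ (i % n + j % n) * p ^ (i / n + j / n) := by ring
        rw [this]
        exact hm (i % n + j % n + (i / n + j / n)) (by omega) _ _ rfl
      · rw [sig_mul, sig_pow, sig_pow, sig_X, sig_self]
        obtain ⟨q, hq⟩ : RR p ∣ (RR p + X) ^ (j / n) - X ^ (j / n) := by
          have := sub_dvd_pow_sub_pow (RR p + X) X (j / n)
          simpa using this
        have h3 : (RR p + X) ^ (j / n) = X ^ (j / n) + RR p * q := by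
          rw [← hq]; ring
        rw [h3]
        have : X ^ (i % n) * p ^ (i / n) * (p ^ (j % n) * (X ^ (j / n) + RR p * q))
          = X ^ (i % n + j / n) * p ^ (i / n + j % n)
            + RR p * (X ^ (i % n) * p ^ (i / n) * p ^ (j % n) * q) := by ring
        rw [this, map_add, h2 _ (Dvd.intro _ rfl), add_zero]
        exact hm (i % n + j / n + (i / n + j % n)) (by omega) _ _ rfl

end KS

namespace KS
open Polynomial

theorem dim_le (N : ℕ) (lam : ℂ[X] →ₗ[ℂ] ℂ)
    (h1 : ∀ g : ℂ[X], g.degree < N → lam g = g.coeff (N - 1))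
    (K U : Submodule ℂ ℂ[X]) (hK : K ≤ degreeLT ℂ N) (hU : U ≤ degreeLT ℂ N)
    (h : ∀ k ∈ K, ∀ u ∈ U, lam (k * u) = 0) :
    Module.finrank ℂ K + Module.finrank ℂ U ≤ N := by
  have hfin : FiniteDimensional ℂ (degreeLT ℂ N) :=
    Module.Finite.equiv (degreeLTEquiv ℂ N).symm
  have hfr : Module.finrank ℂ (degreeLT ℂ N) = N := by
    rw [(degreeLTEquiv ℂ N).finrank_eq]; simp
  let B : K →ₗ[ℂ] Module.Dual ℂ (degreeLT ℂ N) :=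
    ((LinearMap.mul ℂ ℂ[X]).compr₂ lam).domRestrict₁₂ K (degreeLT ℂ N)
  have hB : ∀ (k : K) (u : degreeLT ℂ N), B k u = lam (k.1 * u.1) := fun k u => rfl
  have hinj : Function.Injective B := by
    rw [← LinearMap.ker_eq_bot, LinearMap.ker_eq_bot']
    intro k hk
    by_contra hne
    have hk0 : k.1 ≠ 0 := fun h => hne (Subtype.ext h)
    have hd := mem_degreeLT.mp (hK k.2)
    rw [degree_eq_natDegree hk0, Nat.cast_lt] at hd
    have hu : (X : ℂ[X]) ^ (N - 1 - k.1.natDegree) ∈ degreeLT ℂ N := by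
      rw [mem_degreeLT, degree_X_pow, Nat.cast_lt]; omega
    have h3 := hB k ⟨_, hu⟩
    rw [hk] at h3
    have h4 : (k.1 * (X : ℂ[X]) ^ (N - 1 - k.1.natDegree)).degree < N := by
      rw [degree_mul, degree_X_pow, degree_eq_natDegree hk0, ← Nat.cast_add, Nat.cast_lt]; omega
    rw [h1 _ h4, coeff_mul_X_pow', if_pos (by omega)] at h3
    have h5 : N - 1 - (N - 1 - k.1.natDegree) = k.1.natDegree := by omega
    rw [h5, coeff_natDegree] at h3
    exact leadingCoeff_ne_zero.mpr hk0 h3.symm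
  let U' : Submodule ℂ (degreeLT ℂ N) := U.comap (degreeLT ℂ N).subtype
  have hU' : Module.finrank ℂ U' = Module.finrank ℂ U :=
    (Submodule.comapSubtypeEquivOfLe hU).finrank_eq
  have h6 := Subspace.finrank_add_finrank_dualAnnihilator_eq U'
  have h7 : LinearMap.range B ≤ U'.dualAnnihilator := by
    rintro _ ⟨k, rfl⟩
    rw [Submodule.mem_dualAnnihilator]
    intro u hu
    rw [hB]
    exact h k.1 k.2 u.1 hu
  have h8 := Submodule.finrank_mono h7
  rw [LinearMap.finrank_range_of_inj hinj] at h8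
  omega

/-- multiples of `D` of degree less than `N` -/
noncomputable def PD (N : ℕ) (D : ℂ[X]) : Submodule ℂ ℂ[X] :=
  degreeLT ℂ N ⊓ (Ideal.span {D}).restrictScalars ℂ

theorem mem_PD (N : ℕ) (D g : ℂ[X]) : g ∈ PD N D ↔ g.degree < N ∧ D ∣ g := by
  rw [PD, Submodule.mem_inf, mem_degreeLT, Submodule.restrictScalars_mem, Ideal.mem_span_singleton]

theorem finrank_PD (N : ℕ) (D : ℂ[X]) (hD : D ≠ 0) :
    N ≤ Module.finrank ℂ (PD N D) + D.natDegree := by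
  by_cases hN : N ≤ D.natDegree
  · omega
  have hfin : FiniteDimensional ℂ (degreeLT ℂ N) :=
    Module.Finite.equiv (degreeLTEquiv ℂ N).symm
  have hfin2 : FiniteDimensional ℂ (PD N D) :=
    Submodule.finiteDimensional_of_le (inf_le_left : PD N D ≤ degreeLT ℂ N)
  have hle : (degreeLT ℂ (N - D.natDegree)).map (LinearMap.mulLeft ℂ D) ≤ PD N D := by
    rintro _ ⟨g, hg, rfl⟩
    rw [mem_PD]
    refine ⟨?_, Dvd.intro _ rfl⟩
    rw [LinearMap.mulLeft_apply]
    by_cases hg0 : g = 0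
    · rw [hg0, mul_zero, degree_zero]; exact WithBot.bot_lt_coe _
    rw [SetLike.mem_coe, mem_degreeLT, degree_eq_natDegree hg0, Nat.cast_lt] at hg
    rw [degree_mul, degree_eq_natDegree hD, degree_eq_natDegree hg0, ← Nat.cast_add, Nat.cast_lt]
    omega
  have h1 := Submodule.finrank_mono hle
  have hinj : Function.Injective (LinearMap.mulLeft ℂ D) := by
    intro a b hab
    exact mul_left_cancel₀ hD hab
  rw [← (Submodule.equivMapOfInjective _ hinj _).finrank_eq] at h1
  rw [(degreeLTEquiv ℂ _).finrank_eq] at h1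
  simp at h1
  omega

/-- divisor with prescribed exponents at the roots of `R` -/
noncomputable def DD (R : ℂ[X]) (e : ℂ → ℕ) : ℂ[X] :=
  ∏ z ∈ R.roots.toFinset, (X - C z) ^ e z

theorem DD_ne (R : ℂ[X]) (e : ℂ → ℕ) : DD R e ≠ 0 :=
  Finset.prod_ne_zero_iff.mpr fun z _ => pow_ne_zero _ (X_sub_C_ne_zero z)

theorem natDegree_DD (R : ℂ[X]) (e : ℂ → ℕ) :
    (DD R e).natDegree = ∑ z ∈ R.roots.toFinset, e z := by
  rw [DD, natDegree_prod _ _ fun z _ => pow_ne_zero _ (X_sub_C_ne_zero z)]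
  refine Finset.sum_congr rfl fun z _ => ?_
  rw [natDegree_pow, natDegree_X_sub_C, mul_one]

theorem dvd_DD (R : ℂ[X]) (hR : R ≠ 0) (e : ℂ → ℕ) (z : ℂ) (hz : R.eval z = 0) :
    (X - C z) ^ e z ∣ DD R e := by
  refine Finset.dvd_prod_of_mem (fun z => (X - C z) ^ e z) ?_
  rw [Multiset.mem_toFinset, mem_roots hR]
  exact hz

theorem half (p : ℂ[X]) (hp : 1 < p.natDegree) (lam : ℂ[X] →ₗ[ℂ] ℂ)
    (h1 : ∀ g : ℂ[X], g.degree < (RR p).degree → lam g = g.coeff ((RR p).natDegree - 1))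
    (h2 : ∀ g, RR p ∣ g → lam g = 0) (S : Finset ℂ)
    (hS : ∀ z ∈ S, tau p z = z ∧ 1 < ‖p.derivative.eval z‖) (e₁ e₂ : ℂ → ℕ)
    (ha : ∀ z, (RR p).eval z = 0 → z ∉ S → (RR p).rootMultiplicity z ≤ e₁ z + e₁ (tau p z))
    (hb : ∀ z, (RR p).eval z = 0 → z ∉ S → (RR p).rootMultiplicity z ≤ e₁ z + e₂ z) :
    Module.finrank ℂ (PD (p.natDegree * p.natDegree) (DD (RR p) e₁) ⊓ WW p : Submodule ℂ ℂ[X]) +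
    Module.finrank ℂ (PD (p.natDegree * p.natDegree) (DD (RR p) e₂) ⊔ WW p : Submodule ℂ ℂ[X])
      ≤ p.natDegree * p.natDegree := by
  have hN := natDegree_RR p hp
  have hR0 : RR p ≠ 0 := by
    intro h
    rw [h, natDegree_zero] at hN
    nlinarith
  have hdeg : (RR p).degree = ((p.natDegree * p.natDegree : ℕ) : WithBot ℕ) := by
    rw [degree_eq_natDegree hR0, hN]
  have hpos : ∀ z ∈ S, (0 : ℝ) < ‖p.derivative.eval z‖ ^ 2 - 1 := by
    intro z hz
    nlinarith [(hS z hz).2]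
  have hS' : ∀ z ∈ S, (RR p).eval z = 0 ∧ (RR p).derivative.eval z ≠ 0 := by
    intro z hz
    have hf := (hS z hz).1
    refine ⟨(isRoot_RR p z).mpr (by rw [hf, hf]), ?_⟩
    rw [eval_deriv_RR_fix p z hf]
    exact_mod_cast (hpos z hz).ne'
  apply dim_le _ lam
  · intro g hg
    rw [← hN]
    exact h1 g (by rw [hdeg]; exact hg)
  · exact inf_le_left.trans inf_le_left
  · exact sup_le inf_le_left (WW_le p hp)
  · intro k hk
    obtain ⟨hkP, hkW⟩ := hk
    have hkD : DD (RR p) e₁ ∣ k := ((mem_PD _ _ _).mp hkP).2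
    have hkz : ∀ z, (RR p).eval z = 0 → (X - C z) ^ e₁ z ∣ k := fun z hz =>
      (dvd_DD _ hR0 e₁ z hz).trans hkD
    have hres := residue_sum (RR p) hR0 lam h1 h2 S hS' (k * sig p k) (by
      intro z hz hzS
      have hz2 : (RR p).eval (tau p z) = 0 := by
        rw [isRoot_RR] at hz ⊢
        rw [hz]
      have h3 := mul_dvd_mul (hkz z hz) (sig_dvd p k z _ (hkz _ hz2))
      rw [← pow_add] at h3
      exact (pow_dvd_pow _ (ha z hz hzS)).trans h3) ((lam_WW p hp lam h1 h2 k hkW k hkW).2)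
    have hterm : ∀ z ∈ S, (k * sig p k).eval z / (RR p).derivative.eval z
        = ((‖k.eval z‖ ^ 2 / (‖p.derivative.eval z‖ ^ 2 - 1) : ℝ) : ℂ) := by
      intro z hz
      have hf := (hS z hz).1
      rw [eval_deriv_RR_fix p z hf, eval_mul, eval_sig, hf, Complex.mul_conj,
        Complex.normSq_eq_norm_sq]
      push_cast
      rfl
    rw [Finset.sum_congr rfl hterm, ← Complex.ofReal_sum, Complex.ofReal_eq_zero,
      Finset.sum_eq_zero_iff_of_nonneg (fun z hz => div_nonneg (sq_nonneg _) (hpos z hz).le)] at hres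
    have hvan : ∀ z ∈ S, k.eval z = 0 := by
      intro z hz
      have := hres z hz
      rw [div_eq_zero_iff] at this
      rcases this with h | h
      · simpa using h
      · exact absurd h (hpos z hz).ne'
    intro u hu
    obtain ⟨u1, hu1, u2, hu2, rfl⟩ := Submodule.mem_sup.mp hu
    rw [mul_add, map_add, (lam_WW p hp lam h1 h2 k hkW u2 hu2).1, add_zero]
    apply h2
    apply dvd_of_mult _ _ hR0
    intro z hz
    have huD : DD (RR p) e₂ ∣ u1 := ((mem_PD _ _ _).mp hu1).2
    by_cases hzS : z ∈ S
    · have hm : (RR p).rootMultiplicity z ≤ 1 := by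
        by_contra hlt
        push Not at hlt
        rw [one_lt_rootMultiplicity_iff_isRoot hR0] at hlt
        exact (hS' z hzS).2 hlt.2
      refine (pow_dvd_pow _ hm).trans ?_
      rw [pow_one]
      exact (dvd_iff_isRoot.mpr (hvan z hzS)).mul_right _
    · have h3 := mul_dvd_mul (hkz z hz) ((dvd_DD _ hR0 e₂ z hz).trans huD)
      rw [← pow_add] at h3
      exact (pow_dvd_pow _ (hb z hz hzS)).trans h3

theorem card_rep (p : ℂ[X]) (hp : 1 < p.natDegree) (S T : Finset ℂ)
    (hS : ∀ z, z ∈ S ↔ tau p z = z ∧ 1 < ‖p.derivative.eval z‖)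
    (hT : ∀ z, z ∈ T ↔ tau p z = z ∧ ‖p.derivative.eval z‖ ≤ 1) :
    S.card ≤ p.natDegree + T.card := by
  classical
  have hN := natDegree_RR p hp
  have hR0 : RR p ≠ 0 := by
    intro h
    rw [h, natDegree_zero] at hN
    nlinarith
  obtain ⟨lam, h1, h2⟩ := exists_lam (RR p) hR0
  let m : ℂ → ℕ := fun z => (RR p).rootMultiplicity z
  let e₁ : ℂ → ℕ := fun z => if tau p z = z then (if z ∈ S then 0 else (m z + 1) / 2)
    else if WellOrderingRel z (tau p z) then m z else 0
  let e₂ : ℂ → ℕ := fun z => if tau p z = z then (if z ∈ S then 0 else (m z + 1) / 2)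
    else if WellOrderingRel z (tau p z) then 0 else m z
  have hml : ∀ z, (RR p).eval z = 0 → m z ≤ m (tau p z) := mult_le p hp
  have htau : ∀ z, (RR p).eval z = 0 → tau p (tau p z) = z := fun z hz => (isRoot_RR p z).mp hz
  have ha1 : ∀ z, (RR p).eval z = 0 → z ∉ S → m z ≤ e₁ z + e₁ (tau p z) := by
    intro z hz hzS
    have h3 := hml z hz
    have h4 := htau z hz
    by_cases hf : tau p z = z
    · simp only [e₁, hf, if_true, hzS, if_false]; omega
    · simp only [e₁, h4, hf, Ne.symm hf, if_false]
      rcases trichotomous_of WellOrderingRel z (tau p z) with h | h | h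
      · simp [h]
      · exact absurd h.symm hf
      · simp only [h, if_true]; omega
  have ha2 : ∀ z, (RR p).eval z = 0 → z ∉ S → m z ≤ e₂ z + e₂ (tau p z) := by
    intro z hz hzS
    have h3 := hml z hz
    have h4 := htau z hz
    by_cases hf : tau p z = z
    · simp only [e₂, hf, if_true, hzS, if_false]; omega
    · simp only [e₂, h4, hf, Ne.symm hf, if_false]
      by_cases h : WellOrderingRel z (tau p z)
      · have h' : ¬ WellOrderingRel (tau p z) z := asymm_of WellOrderingRel h
        simp only [h', if_false]; omega
      · simp [h]
  have hb : ∀ z, z ∉ S → m z ≤ e₁ z + e₂ z := by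
    intro z hzS
    simp only [e₁, e₂, hzS, if_false]
    split_ifs <;> omega
  have hA := half p hp lam h1 h2 S (fun z hz => (hS z).mp hz) e₁ e₂ ha1 (fun z _ h => hb z h)
  have hB := half p hp lam h1 h2 S (fun z hz => (hS z).mp hz) e₂ e₁ ha2
    (fun z _ h => (hb z h).trans (add_comm _ _).le)
  set N := p.natDegree * p.natDegree with hNdef
  have hfin : FiniteDimensional ℂ (degreeLT ℂ N) :=
    Module.Finite.equiv (degreeLTEquiv ℂ N).symm
  have hf1 : FiniteDimensional ℂ (PD N (DD (RR p) e₁)) :=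
    Submodule.finiteDimensional_of_le (inf_le_left : PD N _ ≤ degreeLT ℂ N)
  have hf2 : FiniteDimensional ℂ (PD N (DD (RR p) e₂)) :=
    Submodule.finiteDimensional_of_le (inf_le_left : PD N _ ≤ degreeLT ℂ N)
  have hf3 : FiniteDimensional ℂ (WW p) := Submodule.finiteDimensional_of_le (WW_le p hp)
  have hC1 := Submodule.finrank_sup_add_finrank_inf_eq (PD N (DD (RR p) e₁)) (WW p)
  have hC2 := Submodule.finrank_sup_add_finrank_inf_eq (PD N (DD (RR p) e₂)) (WW p)
  have hD1 := finrank_PD N (DD (RR p) e₁) (DD_ne _ _)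
  have hD2 := finrank_PD N (DD (RR p) e₂) (DD_ne _ _)
  rw [natDegree_DD] at hD1 hD2
  have hW := finrank_WW p hp
  have hI := card_idx p.natDegree hp
  have hroot : ∀ z, tau p z = z → z ∈ (RR p).roots.toFinset := by
    intro z hz
    rw [Multiset.mem_toFinset, mem_roots hR0]
    exact (isRoot_RR p z).mpr (by rw [hz, hz])
  have hsum : ∑ z ∈ (RR p).roots.toFinset, (e₁ z + e₂ z + if z ∈ S then 1 else 0)
      ≤ ∑ z ∈ (RR p).roots.toFinset, (m z + if z ∈ T then 1 else 0) := by
    refine Finset.sum_le_sum fun z hz => ?_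
    rw [Multiset.mem_toFinset, mem_roots hR0] at hz
    have hm : 0 < m z := (rootMultiplicity_pos hR0).mpr hz
    by_cases hf : tau p z = z
    · by_cases hzS : z ∈ S
      · simp only [e₁, e₂, hf, hzS, if_true]; omega
      · have hzT : z ∈ T := by
          rw [hT]
          refine ⟨hf, ?_⟩
          rw [hS] at hzS
          by_contra hcon
          exact hzS ⟨hf, not_le.mp hcon⟩
        simp only [e₁, e₂, hf, hzS, hzT, if_true, if_false]; omega
    · have hzS : z ∉ S := fun h => hf ((hS z).mp h).1
      simp only [e₁, e₂, hf, hzS, if_false]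
      split_ifs <;> omega
  have hcardm : ∑ z ∈ (RR p).roots.toFinset, m z = N := by
    have h3 : (RR p).roots.card = N := by
      rw [IsAlgClosed.card_roots_eq_natDegree, hN]
    rw [← h3, ← Multiset.toFinset_sum_count_eq]
    refine Finset.sum_congr rfl fun z _ => ?_
    rw [count_roots]
  have hSc : ∑ z ∈ (RR p).roots.toFinset, (if z ∈ S then 1 else 0) = S.card := by
    rw [Finset.sum_ite_mem, Finset.inter_eq_right.mpr (fun z hz => hroot z ((hS z).mp hz).1)]
    simp
  have hTc : ∑ z ∈ (RR p).roots.toFinset, (if z ∈ T then 1 else 0) = T.card := by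
    rw [Finset.sum_ite_mem, Finset.inter_eq_right.mpr (fun z hz => hroot z ((hT z).mp hz).1)]
    simp
  rw [Finset.sum_add_distrib, Finset.sum_add_distrib, Finset.sum_add_distrib, hSc, hTc,
    hcardm] at hsum
  omega

end KS

/-- Khavinson–Świątek: for a polynomial `p` of degree `n > 1`, the harmonic function
`f(z) = z - conj(p(z))` has at most `3n - 2` zeros. -/
theorem stmt_14 (p : Polynomial ℂ) (hp : 1 < p.natDegree) :
    {z : ℂ | z = (starRingEnd ℂ) (p.eval z)}.Finite ∧
    {z : ℂ | z = (starRingEnd ℂ) (p.eval z)}.ncard ≤ 3 * p.natDegree - 2 := by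
  classical
  have hN := KS.natDegree_RR p hp
  have hR0 : KS.RR p ≠ 0 := by
    intro h
    rw [h, Polynomial.natDegree_zero] at hN
    nlinarith
  have hset : {z : ℂ | z = (starRingEnd ℂ) (p.eval z)}
      = (((KS.RR p).roots.toFinset.filter fun z => KS.tau p z = z : Finset ℂ) : Set ℂ) := by
    ext z
    rw [Finset.coe_filter, Set.mem_ofPred_eq, Set.mem_ofPred_eq, Multiset.mem_toFinset,
      Polynomial.mem_roots hR0]
    constructor
    · intro h
      have hz : KS.tau p z = z := h.symm
      exact ⟨(KS.isRoot_RR p z).mpr (by rw [hz, hz]), hz⟩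
    · intro h
      exact h.2.symm
  have hmem : ∀ z, z ∈ ((KS.RR p).roots.toFinset.filter fun z => KS.tau p z = z)
      ↔ KS.tau p z = z := by
    intro z
    rw [← Finset.mem_coe, ← hset]
    exact eq_comm
  rw [hset, Set.ncard_coe_finset]
  refine ⟨Finset.finite_toSet _, ?_⟩
  set F := ((KS.RR p).roots.toFinset.filter fun z => KS.tau p z = z) with hF
  have hT : ∀ z, z ∈ F.filter (fun z => ‖p.derivative.eval z‖ ≤ 1)
      ↔ KS.tau p z = z ∧ ‖p.derivative.eval z‖ ≤ 1 := by
    intro z; rw [Finset.mem_filter, hmem]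
  have hS : ∀ z, z ∈ F.filter (fun z => ¬ ‖p.derivative.eval z‖ ≤ 1)
      ↔ KS.tau p z = z ∧ 1 < ‖p.derivative.eval z‖ := by
    intro z; rw [Finset.mem_filter, hmem, not_le]
  have h1 := KS.card_nonrepelling p hp _ fun z hz => (hT z).mp hz
  have h2 := KS.card_rep p hp _ _ hS hT
  have h3 := Finset.card_filter_add_card_filter_not (s := F) (fun z => ‖p.derivative.eval z‖ ≤ 1)
  omega
end

section
/- Let h and g be polynomials with real coefficients, regarded as complex polynomials, with deg h = n > deg g. Then the set { z ∈ ℂ : h(z) + conj(g(z)) = 0 and Re(z)·Im(z) ≠ 0 } is finite and contains at most n² − n points. -/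
open Finset in
/-- A finite set of solutions off the real axis has at most `(m+1) * m` points. -/
lemma card_solutions_le (h g : ℕ → ℂ) (m : ℕ) (hl : h (m+1) ≠ 0) (hg : g (m+1) = 0)
    (S : Finset ℂ) (c : ℂ → ℂ)
    (h1 : ∀ z ∈ S, ∑ k ∈ range (m+2), h k * z ^ k + ∑ k ∈ range (m+2), g k * c z ^ k = 0)
    (h2 : ∀ z ∈ S, ∑ k ∈ range (m+2), h k * c z ^ k + ∑ k ∈ range (m+2), g k * z ^ k = 0)
    (h3 : ∀ z ∈ S, z ≠ c z) : S.card ≤ (m+1) * m := by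
  classical
  let M : ℕ → ℕ → (S → ℂ) := fun i j z => (z:ℂ) ^ i * c z ^ j
  let B : Finset (S → ℂ) := (range (m+1) ×ˢ range m).image (fun p => M p.1 p.2)
  let W : Submodule ℂ (S → ℂ) := Submodule.span ℂ (B : Set (S → ℂ))
  have hx : ∀ z ∈ S, z ^ (m+1) = ∑ k ∈ range (m+1), (-h k / h (m+1)) * z ^ k
      + ∑ k ∈ range (m+1), (-g k / h (m+1)) * c z ^ k := by
    intro z hz
    have e := h1 z hz
    rw [sum_range_succ, sum_range_succ _ (m+1), hg] at e
    have e1 : ∀ (f u : ℕ → ℂ), ∑ k ∈ range (m+1), (-f k / h (m+1)) * u k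
        = -(∑ k ∈ range (m+1), f k * u k) / h (m+1) := by
      intro f u
      rw [← sum_neg_distrib, sum_div]
      exact sum_congr rfl fun k _ => by ring
    rw [e1 h (fun k => z ^ k), e1 g (fun k => c z ^ k)]
    field_simp
    linear_combination e
  have hy : ∀ z ∈ S, c z ^ m = -(∑ i ∈ range m, z ^ (i+1) * c z ^ (m - (i+1)))
      + ∑ k ∈ range (m+1), ∑ i ∈ range k, (-(h k - g k) / h (m+1)) * (z ^ i * c z ^ (k-1-i)) := by
    intro z hz
    have e : ∑ k ∈ range (m+2), (h k - g k) * ∑ i ∈ range k, z ^ i * c z ^ (k-1-i) = 0 := by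
      have hne : z - c z ≠ 0 := sub_ne_zero.2 (h3 z hz)
      apply (mul_eq_zero.1 _).resolve_right hne
      rw [sum_mul]
      have : ∀ k ∈ range (m+2), (h k - g k) * (∑ i ∈ range k, z ^ i * c z ^ (k-1-i)) * (z - c z)
          = (h k * z ^ k + g k * c z ^ k) - (h k * c z ^ k + g k * z ^ k) := by
        intro k _
        rw [mul_assoc, geom_sum₂_mul]; ring
      rw [sum_congr rfl this, sum_sub_distrib, sum_add_distrib, sum_add_distrib, h1 z hz, h2 z hz,
        sub_zero]
    rw [sum_range_succ, hg, sum_range_succ' (fun i => z ^ i * c z ^ (m+1-1-i))] at e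
    have e1 : ∑ k ∈ range (m+1), ∑ i ∈ range k,
        (-(h k - g k) / h (m+1)) * (z ^ i * c z ^ (k-1-i))
        = -(∑ k ∈ range (m+1), (h k - g k) * ∑ i ∈ range k, z ^ i * c z ^ (k-1-i)) / h (m+1) := by
      rw [← sum_neg_distrib, sum_div]
      refine sum_congr rfl fun k _ => ?_
      rw [← mul_sum]; ring
    rw [e1]
    simp only [Nat.add_sub_cancel, pow_zero, one_mul, Nat.sub_zero, sub_zero] at e
    field_simp
    linear_combination e
  have key : ∀ d j i, i + j = d → M i j ∈ W := by
    intro d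
    induction d using Nat.strong_induction_on with
    | _ d ihd =>
    intro j
    induction j using Nat.strong_induction_on with
    | _ j ihj =>
    intro i hij
    by_cases hi : m + 1 ≤ i
    · have : M i j = ∑ k ∈ range (m+1), (-h k / h (m+1)) • M (i-(m+1)+k) j
          + ∑ k ∈ range (m+1), (-g k / h (m+1)) • M (i-(m+1)) (j+k) := by
        funext z
        simp only [M, Pi.add_apply, Finset.sum_apply, Pi.smul_apply, smul_eq_mul]
        obtain ⟨a, rfl⟩ := Nat.exists_eq_add_of_le' hi
        rw [pow_add, hx z z.2, Nat.add_sub_cancel, mul_add, add_mul, mul_sum, mul_sum, sum_mul,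
          sum_mul]
        congr 1 <;> exact sum_congr rfl fun k _ => by ring
      rw [this]
      refine W.add_mem (W.sum_mem fun k hk => W.smul_mem _ ?_)
        (W.sum_mem fun k hk => W.smul_mem _ ?_) <;> rw [mem_range] at hk
      · exact ihd (i-(m+1)+k+j) (by omega) _ _ rfl
      · exact ihd (i-(m+1)+(j+k)) (by omega) _ _ rfl
    · by_cases hj : m ≤ j
      · have : M i j = -(∑ k ∈ range m, M (i+(k+1)) (j-m + (m-(k+1))))
            + ∑ k ∈ range (m+1), ∑ l ∈ range k,
              (-(h k - g k) / h (m+1)) • M (i+l) (j-m+(k-1-l)) := by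
          funext z
          simp only [M, Pi.add_apply, Pi.neg_apply, Finset.sum_apply, Pi.smul_apply, smul_eq_mul]
          obtain ⟨a, rfl⟩ := Nat.exists_eq_add_of_le' hj
          rw [pow_add (c z) a, hy z z.2, Nat.add_sub_cancel, mul_add, mul_add, mul_neg, mul_neg,
            mul_sum, mul_sum, mul_sum, mul_sum]
          congr 1
          · congr 1
            exact sum_congr rfl fun k _ => by ring
          · refine sum_congr rfl fun k _ => ?_
            rw [mul_sum, mul_sum]
            exact sum_congr rfl fun k _ => by ring
        rw [this]
        refine W.add_mem (W.neg_mem (W.sum_mem fun k hk => ?_))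
          (W.sum_mem fun k hk => W.sum_mem fun l hl => W.smul_mem _ ?_) <;> rw [mem_range] at hk
        · exact ihj _ (by omega) _ (by omega)
        · rw [mem_range] at hl
          exact ihd (i+l+(j-m+(k-1-l))) (by omega) _ _ rfl
      · apply Submodule.subset_span
        simp only [B, coe_image, Set.mem_image, mem_coe, mem_product, mem_range]
        exact ⟨(i, j), ⟨by omega, by omega⟩, rfl⟩
  have top : W = ⊤ := by
    rw [eq_top_iff]
    intro f _
    let P := Lagrange.interpolate (univ : Finset S) (fun z => (z:ℂ)) f
    have : f = ∑ k ∈ range (P.natDegree+1), P.coeff k • M k 0 := by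
      funext z
      have := Lagrange.eval_interpolate_at_node (s := (univ : Finset S)) (v := fun z => (z:ℂ)) f
        (Subtype.val_injective.injOn) (mem_univ z)
      rw [← this, Polynomial.eval_eq_sum_range]
      simp [M, P]
    rw [this]
    exact W.sum_mem fun k _ => W.smul_mem _ (key _ _ _ rfl)
  have r1 : Module.finrank ℂ W ≤ B.card := finrank_span_finset_le_card B
  rw [top, finrank_top, Module.finrank_fintype_fun_eq_card, Fintype.card_coe] at r1
  refine r1.trans (card_image_le.trans ?_)
  simp

/-- For a harmonic polynomial `f(z) = h(z) + conj(g(z))` with real coefficients and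
`deg h = n > deg g`, the equation `f(z) = 0` has at most `n² - n` solutions with
`Re(z) Im(z) ≠ 0`. -/
theorem stmt_16 (h g : Polynomial ℝ) (n : ℕ) (hn : h.natDegree = n) (hdeg : g.degree < h.degree) :
    {z : ℂ | Polynomial.aeval z h + (starRingEnd ℂ) (Polynomial.aeval z g) = 0 ∧
        z.re * z.im ≠ 0}.Finite ∧
    {z : ℂ | Polynomial.aeval z h + (starRingEnd ℂ) (Polynomial.aeval z g) = 0 ∧
        z.re * z.im ≠ 0}.ncard ≤ n ^ 2 - n := by
  have h0 : h ≠ 0 := by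
    rintro rfl
    simp at hdeg
  have hgc : g.coeff n = 0 := by
    apply Polynomial.coeff_eq_zero_of_degree_lt
    rwa [← hn, ← Polynomial.degree_eq_natDegree h0]
  have hhc : h.coeff n ≠ 0 := by
    rw [← hn]; simpa using h0
  have hgn : g.natDegree ≤ n := hn ▸ Polynomial.natDegree_le_natDegree hdeg.le
  rcases n with _ | m
  · have e : {z : ℂ | Polynomial.aeval z h + (starRingEnd ℂ) (Polynomial.aeval z g) = 0 ∧
        z.re * z.im ≠ 0} = ∅ := by
      ext z
      rw [Polynomial.eq_C_of_natDegree_eq_zero hn,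
        Polynomial.eq_C_of_natDegree_eq_zero (Nat.le_zero.1 hgn), hgc]
      simp [hhc]
    rw [e]; simp
  set T := {z : ℂ | Polynomial.aeval z h + (starRingEnd ℂ) (Polynomial.aeval z g) = 0 ∧
        z.re * z.im ≠ 0} with hT
  have main : ∀ S : Finset ℂ, (S : Set ℂ) ⊆ T → S.card ≤ (m+1) * m := by
    intro S hS
    have ha : ∀ z ∈ S, Polynomial.aeval z h + Polynomial.aeval (starRingEnd ℂ z) g = 0 := by
      intro z hz
      rw [Polynomial.aeval_conj]
      exact (hS hz).1
    have hb : ∀ z ∈ S, Polynomial.aeval (starRingEnd ℂ z) h + Polynomial.aeval z g = 0 := by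
      intro z hz
      have := congrArg (starRingEnd ℂ) (hS hz).1
      rw [Polynomial.aeval_conj]
      simpa using this
    have eh : ∀ z : ℂ, Polynomial.aeval z h
        = ∑ k ∈ Finset.range (m+2), (h.coeff k : ℂ) * z ^ k := by
      intro z
      rw [Polynomial.aeval_eq_sum_range' (n := m+2) (by omega)]
      simp
    have eg : ∀ z : ℂ, Polynomial.aeval z g
        = ∑ k ∈ Finset.range (m+2), (g.coeff k : ℂ) * z ^ k := by
      intro z
      rw [Polynomial.aeval_eq_sum_range' (n := m+2) (by omega)]
      simp
    refine card_solutions_le (fun k => (h.coeff k : ℂ)) (fun k => (g.coeff k : ℂ)) m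
      (by simpa using hhc) (by simpa using hgc) S (starRingEnd ℂ) ?_ ?_ ?_
    · intro z hz
      rw [← eh, ← eg]; exact ha z hz
    · intro z hz
      rw [← eh, ← eg]; exact hb z hz
    · intro z hz e
      have := (hS hz).2
      have h3 : z.im = 0 := Complex.conj_eq_iff_im.1 e.symm
      simp [h3] at this
  have fin : T.Finite := by
    by_contra hinf
    obtain ⟨S, hS, hc⟩ := Set.Infinite.exists_subset_card_eq hinf ((m+1) * m + 1)
    have := main S hS
    omega
  refine ⟨fin, ?_⟩
  rw [Set.ncard_eq_toFinset_card T fin]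
  have := main fin.toFinset (by simp)
  have e : (m+1)^2 - (m+1) = (m+1) * m := by
    rw [Nat.sub_eq_iff_eq_add (by nlinarith)]; ring
  omega
end
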